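/- arXiv:2502.01082 — 2 statements merged into one kernel-verified Lean document; each statement's English description precedes it below -/
import Mathlib

section
/- (Definable Sard's theorem.) Suppose the structure on ℝ is d-minimal. Let M be a D¹ submanifold of ℝ^m of dimension d and let f = (f₁,…,f_n) : M → ℝⁿ be a D¹ map. Then the set of critical values of f (the images f(x) of points x ∈ M at which the differential d_xf : T_xM → ℝⁿ is not surjective) is a definable set of dimension strictly smaller than n. -/
open FirstOrder Set Filter Topology
open scoped Classical

noncomputable section

namespace DMinPaper

variable (L : FirstOrder.Language) [L.Structure ℝ]

/-- A subset of `ℝ^α` is definable (with parameters from `ℝ`) in the structure `L`. -/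
def IsDef {α : Type} (s : Set (α → ℝ)) : Prop :=
  (Set.univ : Set ℝ).Definable L s

/-- Definability of an `ℝ`-valued function on a subset `M ⊆ ℝ^α`, via its graph. -/
def IsDefFunOn {α : Type} (M : Set (α → ℝ)) (f : (α → ℝ) → ℝ) : Prop :=
  IsDef L {z : (α ⊕ Unit) → ℝ |
    (fun i => z (Sum.inl i)) ∈ M ∧ z (Sum.inr ()) = f (fun i => z (Sum.inl i))}

/-- Definability of a map `M → ℝ^β` on a subset `M ⊆ ℝ^α`, via its graph. -/
def IsDefMapOn {α β : Type} (M : Set (α → ℝ)) (f : (α → ℝ) → (β → ℝ)) : Prop :=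
  IsDef L {z : (α ⊕ β) → ℝ |
    (fun i => z (Sum.inl i)) ∈ M ∧ (fun j => z (Sum.inr j)) = f (fun i => z (Sum.inl i))}

/-- Definability of an `ℝ`-valued function on a subset of a product `ℝ^α × ℝ^β`. -/
def IsDefFun2On {α β : Type} (S : Set ((α → ℝ) × (β → ℝ)))
    (f : (α → ℝ) × (β → ℝ) → ℝ) : Prop :=
  IsDef L {z : ((α ⊕ β) ⊕ Unit) → ℝ |
    ((fun i => z (Sum.inl (Sum.inl i)), fun j => z (Sum.inl (Sum.inr j))) ∈ S) ∧
    z (Sum.inr ()) = f (fun i => z (Sum.inl (Sum.inl i)), fun j => z (Sum.inl (Sum.inr j)))}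

/-- Definability of a map into `ℝ^γ` on a subset of a product `ℝ^α × ℝ^β`. -/
def IsDefMap2On {α β γ : Type} (S : Set ((α → ℝ) × (β → ℝ)))
    (f : (α → ℝ) × (β → ℝ) → (γ → ℝ)) : Prop :=
  IsDef L {z : ((α ⊕ β) ⊕ γ) → ℝ |
    ((fun i => z (Sum.inl (Sum.inl i)), fun j => z (Sum.inl (Sum.inr j))) ∈ S) ∧
    (fun l => z (Sum.inr l)) = f (fun i => z (Sum.inl (Sum.inl i)), fun j => z (Sum.inl (Sum.inr j)))}

/-- Definability of a function `ℝ → ℝ`, via its graph. -/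
def IsDefFunR (f : ℝ → ℝ) : Prop :=
  IsDef L {z : Fin 2 → ℝ | z 1 = f (z 0)}

/-- The structure expands the ordered field of real numbers: the order, addition and
multiplication are definable. -/
def ExpandsOrderedField : Prop :=
  IsDef L {x : Fin 2 → ℝ | x 0 < x 1} ∧
  IsDef L {x : Fin 3 → ℝ | x 2 = x 0 + x 1} ∧
  IsDef L {x : Fin 3 → ℝ | x 2 = x 0 * x 1}

/-- A discrete subset of `ℝ`. -/
def IsDiscreteSet (D : Set ℝ) : Prop :=
  ∀ x ∈ D, ∃ U : Set ℝ, IsOpen U ∧ U ∩ D = {x}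

/-- d-minimality: the structure expands the ordered field of reals, and in every definable
family of subsets of `ℝ` each fiber is the union of an open set and `N` discrete sets, where
`N` does not depend on the parameter. -/
def DMinimal : Prop :=
  ExpandsOrderedField L ∧
  ∀ (k : ℕ) (S : Set ((Fin k ⊕ Unit) → ℝ)), IsDef L S →
    ∃ N : ℕ, ∀ a : Fin k → ℝ,
      ∃ (U : Set ℝ) (D : Fin N → Set ℝ),
        IsOpen U ∧ (∀ i, IsDiscreteSet (D i)) ∧
        {t : ℝ | Sum.elim a (fun _ => t) ∈ S} = U ∪ ⋃ i, D i

variable {E F : Type} [NormedAddCommGroup E] [NormedSpace ℝ E]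
  [NormedAddCommGroup F] [NormedSpace ℝ F]

/-- `f` is of class `C^p` on `M` (as a function on the submanifold `M`): near each point of `M`
it coincides on `M` with a `C^p` function defined on an ambient open set. -/
def CpOn (p : ℕ) (f : E → F) (M : Set E) : Prop :=
  ∀ x ∈ M, ∃ (U : Set E) (g : E → F),
    IsOpen U ∧ x ∈ U ∧ ContDiffOn ℝ p g U ∧ Set.EqOn f g (M ∩ U)

/-- The tangent vectors to `M` at `x`: velocities of differentiable curves through `x`
staying in `M`. -/
def TangentVecs (M : Set E) (x : E) : Set E :=
  {v | ∃ γ : ℝ → E, γ 0 = x ∧ (∀ᶠ t in 𝓝 (0:ℝ), γ t ∈ M) ∧ HasDerivAt γ v 0}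

/-- The differential of `f : M → N` at `x` is surjective onto the tangent space of `N`
at `f x`. -/
def SubmersionAtOn (f : E → F) (M : Set E) (N : Set F) (x : E) : Prop :=
  ∀ w ∈ TangentVecs N (f x), ∃ (γ : ℝ → E) (v : E),
    γ 0 = x ∧ (∀ᶠ t in 𝓝 (0:ℝ), γ t ∈ M) ∧ HasDerivAt γ v 0 ∧
    HasDerivAt (fun t => f (γ t)) w 0

/-- `x` is a critical point of `f : M → ℝ`: the differential of `f` at `x` vanishes on all
tangent vectors of `M` at `x`. -/
def IsCritPtOn (f : E → ℝ) (M : Set E) (x : E) : Prop :=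
  x ∈ M ∧ ∀ (γ : ℝ → E) (v : E), γ 0 = x → (∀ᶠ t in 𝓝 (0:ℝ), γ t ∈ M) →
    HasDerivAt γ v 0 → HasDerivAt (fun t => f (γ t)) 0 0

/-- `x` is a nondegenerate critical point of `f : M → ℝ` on the `d`-dimensional submanifold
`M`: in a local `C²` parametrization `ψ` of `M` at `x`, the Hessian of `f ∘ ψ` is a
nondegenerate bilinear form. -/
def IsNondegCritPtOn (f : E → ℝ) (M : Set E) (d : ℕ) (x : E) : Prop :=
  IsCritPtOn f M x ∧
  ∃ (W : Set (Fin d → ℝ)) (ψ : (Fin d → ℝ) → E) (w0 : Fin d → ℝ),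
    IsOpen W ∧ w0 ∈ W ∧ ContDiffOn ℝ 2 ψ W ∧ ψ w0 = x ∧ Set.MapsTo ψ W M ∧
    Function.Injective (fun u => fderiv ℝ ψ w0 u) ∧
    ∀ v : Fin d → ℝ, v ≠ 0 → ∃ w : Fin d → ℝ,
      iteratedFDeriv ℝ 2 (fun z => f (ψ z)) w0 ![v, w] ≠ 0

/-- `f` is a Morse function on the `d`-dimensional submanifold `M`: all critical points are
nondegenerate and distinct critical points have distinct critical values. -/
def IsMorseOn (f : E → ℝ) (M : Set E) (d : ℕ) : Prop :=
  (∀ x, IsCritPtOn f M x → IsNondegCritPtOn f M d x) ∧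
  ∀ x y, IsCritPtOn f M x → IsCritPtOn f M y → x ≠ y → f x ≠ f y

/-- `M ⊆ ℝⁿ` is a definable `C^p` submanifold of dimension `d`: `M` is definable and every
point of `M` has a definable `C^p` chart of `ℝⁿ` flattening `M` onto `ℝ^d × {0}`. -/
def IsDpSubmanifold (p : ℕ) {n : ℕ} (d : ℕ) (M : Set (Fin n → ℝ)) : Prop :=
  IsDef L M ∧ d ≤ n ∧
  ∀ x ∈ M, ∃ (U V : Set (Fin n → ℝ)) (φ ψ : (Fin n → ℝ) → (Fin n → ℝ)),
    IsOpen U ∧ x ∈ U ∧ IsOpen V ∧ (0 : Fin n → ℝ) ∈ V ∧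
    IsDef L U ∧ IsDef L V ∧ IsDefMapOn L U φ ∧ IsDefMapOn L V ψ ∧
    ContDiffOn ℝ p φ U ∧ ContDiffOn ℝ p ψ V ∧
    Set.MapsTo φ U V ∧ Set.MapsTo ψ V U ∧
    (∀ y ∈ U, ψ (φ y) = y) ∧ (∀ y ∈ V, φ (ψ y) = y) ∧
    φ x = 0 ∧ φ '' (M ∩ U) = V ∩ {y | ∀ i : Fin n, d ≤ (i : ℕ) → y i = 0}

/-- The definable set `X ⊆ ℝⁿ` has dimension at least `d`: some projection of `X` onto `d`
of the coordinates has nonempty interior. -/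
def hasDimGE {n : ℕ} (X : Set (Fin n → ℝ)) (d : ℕ) : Prop :=
  ∃ ι : Fin d → Fin n, StrictMono ι ∧ (interior ((fun x => fun i => x (ι i)) '' X)).Nonempty

/-- The dimension of `X ⊆ ℝⁿ`: the largest `d` such that some coordinate projection of `X`
onto `ℝ^d` has nonempty interior; `⊥` (i.e. `-∞`) for the empty set. -/
noncomputable def dimDef {n : ℕ} (X : Set (Fin n → ℝ)) : WithBot ℕ :=
  if X.Nonempty then ((sSup {d : ℕ | hasDimGE X d} : ℕ) : WithBot ℕ) else ⊥

/-- The coordinate projection `ℝⁿ → ℝ^d` determined by `ι`. -/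
def projc {n d : ℕ} (ι : Fin d → Fin n) (x : Fin n → ℝ) : Fin d → ℝ := fun i => x (ι i)

/-- An open box in `ℝⁿ`: a product of `n` nonempty open intervals. -/
def IsOpenBox {n : ℕ} (U : Set (Fin n → ℝ)) : Prop :=
  ∃ a b : Fin n → ℝ, (∀ i, a i < b i) ∧ U = Set.univ.pi fun i => Set.Ioo (a i) (b i)

/-- `M` is locally, at `x`, the image of a definable `C^p` section `τ` of the coordinate
projection `projc ι`. -/
def MultiGraphPtAt (p : ℕ) {n d : ℕ} (ι : Fin d → Fin n) (M : Set (Fin n → ℝ))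
    (x : Fin n → ℝ) : Prop :=
  ∃ U : Set (Fin n → ℝ), IsOpenBox U ∧ x ∈ U ∧
    ∃ τ : (Fin d → ℝ) → (Fin n → ℝ),
      IsDefMapOn L (projc ι '' U) τ ∧ ContDiffOn ℝ p τ (projc ι '' U) ∧
      M ∩ U = τ '' (projc ι '' U) ∧ ∀ z ∈ projc ι '' U, projc ι (τ z) = z

/-- A `D^p` multi-valued graph with respect to the coordinate projection `projc ι`. -/
def IsMultiGraph (p : ℕ) {n d : ℕ} (ι : Fin d → Fin n) (M : Set (Fin n → ℝ)) : Prop :=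
  IsDpSubmanifold L p d M ∧ ∀ x ∈ M, MultiGraphPtAt L p ι M x

/-- The gradient vector `(∂g/∂x₁, …, ∂g/∂x_d)` of `g : ℝ^d → ℝ` at `z`. -/
noncomputable def gradVec {d : ℕ} (g : (Fin d → ℝ) → ℝ) (z : Fin d → ℝ) : Fin d → ℝ :=
  fun i => fderiv ℝ g z (Pi.single i 1)

/-- The Hessian matrix `(∂²g/∂x_i∂x_j)` of `g : ℝ^d → ℝ` at `z`. -/
noncomputable def hessMat {d : ℕ} (g : (Fin d → ℝ) → ℝ) (z : Fin d → ℝ) :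
    Matrix (Fin d) (Fin d) ℝ :=
  Matrix.of fun i j => fderiv ℝ (fun w => fderiv ℝ g w (Pi.single j 1)) z (Pi.single i 1)

/-- The derivative of `f : M → ℝ` at `x` along the vector field `D`: the common value of
`d_x g (D x)` over all local `C¹` extensions `g` of `f` (and `0` if there is no such common
value). -/
noncomputable def vderiv (M : Set E) (D : E → E) (f : E → ℝ) (x : E) : ℝ :=
  if h : ∃ w : ℝ, ∀ (U : Set E) (g : E → ℝ), IsOpen U → x ∈ U → ContDiffOn ℝ 1 g U →
      Set.EqOn f g (M ∩ U) → fderiv ℝ g x (D x) = w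
  then h.choose else 0

/-- Iterated derivative `D_{α₁} ⋯ D_{α_m} f` of `f : M → ℝ` along a finite family of vector
fields, indexed by a list `α`. -/
noncomputable def vderivIter {k : ℕ} (M : Set E) (D : Fin k → E → E) :
    List (Fin k) → (E → ℝ) → E → ℝ
  | [], f => f
  | i :: l, f => vderiv M (D i) (vderivIter M D l f)


set_option linter.unusedVariables false
set_option linter.unusedSectionVars false
set_option linter.style.haveILetI false

/-! ### Definability framework -/

class Coo (X : Type) where
  ι : Type
  fin : Finite ι
  e : X ≃ (ι → ℝ)

instance : Coo ℝ := ⟨Unit, inferInstance, (Equiv.funUnique Unit ℝ).symm⟩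

instance (n : ℕ) : Coo (Fin n → ℝ) := ⟨Fin n, inferInstance, Equiv.refl _⟩

instance {X Y : Type} [Coo X] [Coo Y] : Coo (X × Y) :=
  ⟨Coo.ι X ⊕ Coo.ι Y, by
    have := Coo.fin (X := X); have := Coo.fin (X := Y); infer_instance,
   (Equiv.prodCongr Coo.e Coo.e).trans (Equiv.sumArrowEquivProdArrow _ _ _).symm⟩

section Framework

variable {X Y Z : Type} [Coo X] [Coo Y] [Coo Z]

def Dp (P : X → Prop) : Prop := IsDef L {z : Coo.ι X → ℝ | P (Coo.e.symm z)}

def IsProj (f : X → Y) : Prop :=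
  ∃ σ : Coo.ι Y → Coo.ι X, ∀ x, Coo.e (f x) = Coo.e x ∘ σ

theorem IsProj.fst' : IsProj (Prod.fst : X × Y → X) := ⟨Sum.inl, fun x => rfl⟩
theorem IsProj.snd' : IsProj (Prod.snd : X × Y → Y) := ⟨Sum.inr, fun x => rfl⟩
theorem IsProj.id' : IsProj (fun x : X => x) := ⟨id, fun x => rfl⟩
theorem IsProj.comp' {f : X → Y} {g : Y → Z} (hg : IsProj g) (hf : IsProj f) :
    IsProj (fun x => g (f x)) := by
  obtain ⟨σ, hσ⟩ := hf
  obtain ⟨τ, hτ⟩ := hg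
  exact ⟨σ ∘ τ, fun x => by rw [hτ, hσ]; rfl⟩
theorem IsProj.pair' {f : X → Y} {g : X → Z} (hf : IsProj f) (hg : IsProj g) :
    IsProj (fun x => (f x, g x)) := by
  obtain ⟨σ, hσ⟩ := hf
  obtain ⟨τ, hτ⟩ := hg
  refine ⟨Sum.elim σ τ, fun x => ?_⟩
  funext j
  rcases j with j | j
  · exact congrFun (hσ x) j
  · exact congrFun (hτ x) j
theorem IsProj.eval' {n : ℕ} (i : Fin n) : IsProj (fun x : Fin n → ℝ => x i) :=
  ⟨fun _ => i, fun x => rfl⟩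
theorem IsProj.pi' {n : ℕ} {f : X → Fin n → ℝ} (hf : ∀ i, IsProj (fun x => f x i)) :
    IsProj f := by
  choose σ hσ using hf
  exact ⟨fun i => σ i (), fun x => funext fun i => congrFun (hσ i x) ()⟩

variable {L}

theorem Dp.proj {P : Y → Prop} (hP : Dp L P) {f : X → Y} (hf : IsProj f) :
    Dp L (fun x => P (f x)) := by
  obtain ⟨σ, hσ⟩ := hf
  have := Set.Definable.preimage_comp (σ) hP
  unfold Dp IsDef
  convert this using 1
  ext z
  simp only [mem_ofPred_eq, mem_preimage]
  have h := hσ (Coo.e.symm z)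
  rw [Equiv.apply_symm_apply] at h
  rw [← h, Equiv.symm_apply_apply]

theorem Dp.congr {P Q : X → Prop} (hP : Dp L P) (h : ∀ x, Q x ↔ P x) : Dp L Q := by
  have : Q = P := funext fun x => propext (h x)
  rw [this]; exact hP

theorem Dp.and {P Q : X → Prop} (hP : Dp L P) (hQ : Dp L Q) : Dp L (fun x => P x ∧ Q x) :=
  Set.Definable.inter hP hQ
theorem Dp.or {P Q : X → Prop} (hP : Dp L P) (hQ : Dp L Q) : Dp L (fun x => P x ∨ Q x) :=
  Set.Definable.union hP hQ
theorem Dp.not {P : X → Prop} (hP : Dp L P) : Dp L (fun x => ¬ P x) :=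
  Set.Definable.compl hP
theorem Dp.imp {P Q : X → Prop} (hP : Dp L P) (hQ : Dp L Q) : Dp L (fun x => P x → Q x) :=
  (hP.not.or hQ).congr fun x => by tauto
theorem Dp.ex {P : X → Y → Prop} (hP : Dp L (fun p : X × Y => P p.1 p.2)) :
    Dp L (fun x => ∃ y, P x y) := by
  have := Coo.fin (X := X)
  have := Coo.fin (X := Y)
  have h := Set.Definable.exists_of_finite (α := Coo.ι X) (β := Coo.ι Y) hP
  unfold Dp IsDef
  convert h using 1
  ext z
  constructor
  · rintro ⟨y, hy⟩
    refine ⟨Coo.e y, ?_⟩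
    change P (Coo.e.symm z) (Coo.e.symm (Coo.e y))
    rw [Equiv.symm_apply_apply]
    exact hy
  · rintro ⟨u, hu⟩
    exact ⟨Coo.e.symm u, hu⟩
theorem Dp.all {P : X → Y → Prop} (hP : Dp L (fun p : X × Y => P p.1 p.2)) :
    Dp L (fun x => ∀ y, P x y) :=
  (Dp.ex (P := fun x y => ¬ P x y) hP.not).not.congr fun x => by push Not; rfl
theorem Dp.allFin {I : Type} [Finite I] {P : I → X → Prop} (hP : ∀ i, Dp L (P i)) :
    Dp L (fun x => ∀ i, P i x) := by
  have h := Set.definable_iInter_of_finite hP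
  unfold Dp IsDef
  convert h using 1
  ext z
  rw [Set.mem_iInter]
  rfl

variable [hL : Fact (DMinimal L)]

theorem Dp.lt0 : Dp L (fun p : ℝ × ℝ => p.1 < p.2) :=
  Set.Definable.preimage_comp (![Sum.inl (), Sum.inr ()] : Fin 2 → Unit ⊕ Unit) hL.out.1.1
theorem Dp.add0 : Dp L (fun p : (ℝ × ℝ) × ℝ => p.1.1 + p.1.2 = p.2) := by
  refine Dp.congr (P := fun p : (ℝ × ℝ) × ℝ => p.2 = p.1.1 + p.1.2) ?_ fun x => eq_comm
  exact Set.Definable.preimage_comp (![Sum.inl (Sum.inl ()), Sum.inl (Sum.inr ()), Sum.inr ()] :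
    Fin 3 → (Unit ⊕ Unit) ⊕ Unit) hL.out.1.2.1
theorem Dp.mul0 : Dp L (fun p : (ℝ × ℝ) × ℝ => p.1.1 * p.1.2 = p.2) := by
  refine Dp.congr (P := fun p : (ℝ × ℝ) × ℝ => p.2 = p.1.1 * p.1.2) ?_ fun x => eq_comm
  exact Set.Definable.preimage_comp (![Sum.inl (Sum.inl ()), Sum.inl (Sum.inr ()), Sum.inr ()] :
    Fin 3 → (Unit ⊕ Unit) ⊕ Unit) hL.out.1.2.2
theorem Dp.eqR : Dp L (fun p : ℝ × ℝ => p.1 = p.2) :=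
  (Dp.lt0.not.and (Dp.lt0.proj (IsProj.snd'.pair' IsProj.fst')).not).congr fun x => by
    constructor
    · intro h; simp [h]
    · rintro ⟨h1, h2⟩; exact le_antisymm (not_lt.1 h2) (not_lt.1 h1)
theorem Dp.constR (c : ℝ) : Dp L (fun x : ℝ => c = x) := by
  refine Dp.congr (P := fun x : ℝ => x = c) ?_ fun x => eq_comm
  exact Set.Definable.preimage_comp (fun _ => () : Fin 1 → Unit)
    (Set.Definable.singleton_of_mem L (a := c) (A := Set.univ) trivial)

theorem IsProj.coord (j : Coo.ι X) : IsProj (fun x : X => (Coo.e x j : ℝ)) :=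
  ⟨fun _ => j, fun _ => rfl⟩

theorem Dp.eq0 : Dp L (fun p : X × X => p.1 = p.2) := by
  have := Coo.fin (X := X)
  refine Dp.congr (P := fun p : X × X => ∀ j, Coo.e p.1 j = Coo.e p.2 j) ?_ fun p => ?_
  · exact Dp.allFin fun j =>
      Dp.eqR.proj (((IsProj.coord j).comp' IsProj.fst').pair' ((IsProj.coord j).comp' IsProj.snd'))
  · rw [← funext_iff, Equiv.apply_eq_iff_eq]
theorem Dp.const0 (c : X) : Dp L (fun x : X => c = x) := by
  have := Coo.fin (X := X)
  refine Dp.congr (P := fun p : X => ∀ j, Coo.e c j = Coo.e p j) ?_ fun p => ?_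
  · exact Dp.allFin fun j => (Dp.constR _).proj (IsProj.coord j)
  · rw [← funext_iff, Equiv.apply_eq_iff_eq]

variable (L) in
/-- definable maps -/
@[fun_prop]
def DM (f : X → Y) : Prop := Dp L (fun p : X × Y => f p.1 = p.2)

theorem IsProj.dm {f : X → Y} (hf : IsProj f) : DM L f :=
  Dp.eq0.proj ((hf.comp' IsProj.fst').pair' IsProj.snd')

@[fun_prop] theorem DM.id' : DM L (fun x : X => x) := IsProj.id'.dm
@[fun_prop] theorem DM.const' (c : Y) : DM L (fun _ : X => c) := (Dp.const0 c).proj IsProj.snd'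
@[fun_prop] theorem DM.comp' {g : Y → Z} {f : X → Y} (hg : DM L g) (hf : DM L f) :
    DM L (fun x => g (f x)) := by
  refine Dp.congr (P := fun p : X × Z => ∃ y, f p.1 = y ∧ g y = p.2) ?_ fun p => ?_
  · refine Dp.ex (Dp.and ?_ ?_)
    · exact Dp.proj hf ((IsProj.fst'.comp' IsProj.fst').pair' IsProj.snd')
    · exact Dp.proj hg (IsProj.snd'.pair' (IsProj.snd'.comp' IsProj.fst'))
  · simp
@[fun_prop] theorem DM.pair {f : X → Y} {g : X → Z} (hf : DM L f) (hg : DM L g) :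
    DM L (fun x => (f x, g x)) := by
  refine Dp.congr (P := fun p : X × (Y × Z) => f p.1 = p.2.1 ∧ g p.1 = p.2.2) ?_ fun p => ?_
  · refine Dp.and ?_ ?_
    · exact Dp.proj hf (IsProj.fst'.pair' (IsProj.fst'.comp' IsProj.snd'))
    · exact Dp.proj hg (IsProj.fst'.pair' (IsProj.snd'.comp' IsProj.snd'))
  · rw [Prod.ext_iff]
@[fun_prop] theorem DM.fst {f : X → Y × Z} (hf : DM L f) : DM L (fun x => (f x).1) :=
  (IsProj.fst'.dm (L := L)).comp' hf
@[fun_prop] theorem DM.snd {f : X → Y × Z} (hf : DM L f) : DM L (fun x => (f x).2) :=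
  (IsProj.snd'.dm (L := L)).comp' hf
@[fun_prop] theorem DM.pi {n : ℕ} {f : X → Fin n → ℝ} (hf : ∀ i, DM L (fun x => f x i)) :
    DM L f := by
  refine Dp.congr (P := fun p : X × (Fin n → ℝ) => ∀ i, f p.1 i = p.2 i) ?_ fun p => ?_
  · exact Dp.allFin fun i => Dp.proj (hf i)
      (IsProj.fst'.pair' ((IsProj.eval' i).comp' IsProj.snd'))
  · rw [funext_iff]
@[fun_prop] theorem DM.ev {n : ℕ} (i : Fin n) : DM L (fun x : Fin n → ℝ => x i) :=
  (IsProj.eval' i).dm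
@[fun_prop] theorem DM.add {f g : X → ℝ} (hf : DM L f) (hg : DM L g) :
    DM L (fun x => f x + g x) :=
  DM.comp' (g := fun p : ℝ × ℝ => p.1 + p.2) Dp.add0 (hf.pair hg)
@[fun_prop] theorem DM.mul {f g : X → ℝ} (hf : DM L f) (hg : DM L g) :
    DM L (fun x => f x * g x) :=
  DM.comp' (g := fun p : ℝ × ℝ => p.1 * p.2) Dp.mul0 (hf.pair hg)

theorem Dp.comp {P : Y → Prop} (hP : Dp L P) {f : X → Y} (hf : DM L f) :
    Dp L (fun x => P (f x)) := by
  refine Dp.congr (P := fun x => ∃ y, f x = y ∧ P y) ?_ fun p => ?_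
  · exact Dp.ex (Dp.and hf (hP.proj IsProj.snd'))
  · simp
theorem Dp.eq {f g : X → Y} (hf : DM L f) (hg : DM L g) : Dp L (fun x => f x = g x) :=
  Dp.comp (P := fun p : Y × Y => p.1 = p.2) Dp.eq0 (hf.pair hg)
theorem Dp.lt {f g : X → ℝ} (hf : DM L f) (hg : DM L g) : Dp L (fun x => f x < g x) :=
  Dp.comp (P := fun p : ℝ × ℝ => p.1 < p.2) Dp.lt0 (hf.pair hg)
theorem Dp.le {f g : X → ℝ} (hf : DM L f) (hg : DM L g) : Dp L (fun x => f x ≤ g x) :=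
  (Dp.lt hg hf).not.congr fun _ => not_lt.symm
@[fun_prop] theorem DM.neg {f : X → ℝ} (hf : DM L f) : DM L (fun x => - f x) := by
  have : DM L (fun x => (-1) * f x) := by fun_prop
  simpa using this
@[fun_prop] theorem DM.sub {f g : X → ℝ} (hf : DM L f) (hg : DM L g) :
    DM L (fun x => f x - g x) := by
  simp only [sub_eq_add_neg]; fun_prop
@[fun_prop] theorem DM.abs {f : X → ℝ} (hf : DM L f) : DM L (fun x => |f x|) := by
  refine Dp.congr (P := fun p : X × ℝ => 0 ≤ p.2 ∧ (f p.1 = p.2 ∨ f p.1 = - p.2)) ?_ fun p => ?_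
  · refine Dp.and (Dp.le (by fun_prop) (by fun_prop)) (Dp.or (Dp.eq ?_ ?_) (Dp.eq ?_ ?_)) <;> fun_prop
  · constructor
    · intro h
      exact ⟨h ▸ abs_nonneg _, (abs_eq (h ▸ abs_nonneg _)).1 h⟩
    · rintro ⟨h1, h2⟩
      exact (abs_eq h1).2 h2

/-- A functional relation yields a definable function. -/
theorem exists_fun {G : X × ℝ → Prop} (hG : Dp L G)
    (hf : ∀ x s t, G (x, s) → G (x, t) → s = t) :
    ∃ g : X → ℝ, DM L g ∧ ∀ x t, G (x, t) → g x = t := by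
  have key : ∀ x t, G (x, t) → (if h : ∃ t, G (x, t) then h.choose else 0) = t := by
    intro x t h
    have h' : ∃ t, G (x, t) := ⟨t, h⟩
    rw [dif_pos h']
    exact hf _ _ _ h'.choose_spec h
  refine ⟨fun x => if h : ∃ t, G (x, t) then h.choose else 0, ?_, key⟩
  refine Dp.congr (P := fun p : X × ℝ => G p ∨ ((¬ ∃ t, G (p.1, t)) ∧ p.2 = 0)) ?_ ?_
  · refine hG.or (Dp.and (Dp.not (Dp.ex ?_)) (Dp.eq ?_ ?_))
    · exact hG.comp (f := fun q : (X × ℝ) × ℝ => (q.1.1, q.2)) (by fun_prop)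
    · fun_prop
    · fun_prop
  · rintro ⟨x, t⟩
    constructor
    · intro h
      by_cases h' : ∃ t, G (x, t)
      · left
        obtain ⟨s, hs⟩ := h'
        have := key x s hs
        simp only at h
        rw [this] at h
        exact h ▸ hs
      · right
        refine ⟨h', ?_⟩
        simp only at h
        rw [dif_neg h'] at h
        exact h.symm
    · rintro (h | ⟨h1, h2⟩)
      · exact key x t h
      · simp only at h1 h2 ⊢
        rw [dif_neg h1, h2]

/-- fibers: d-minimality for definable subsets of the line -/
theorem dmin_line {P : ℝ → Prop} (hP : Dp L P) :
    ∃ (N : ℕ) (U : Set ℝ) (D : Fin N → Set ℝ), IsOpen U ∧ (∀ i, IsDiscreteSet (D i)) ∧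
      {t | P t} = U ∪ ⋃ i, D i := by
  have h : IsDef L {z : (Fin 0 ⊕ Unit) → ℝ | P (z (Sum.inr ()))} :=
    Set.Definable.preimage_comp (Sum.inr : Unit → Fin 0 ⊕ Unit) hP
  obtain ⟨N, hN⟩ := hL.out.2 0 _ h
  obtain ⟨U, D, h1, h2, h3⟩ := hN (fun i => i.elim0)
  exact ⟨N, U, D, h1, h2, h3⟩

end Framework

/-! ### Cantor–Bendixson derivatives and decomposition into graphs -/

section Decomp

def cbl (P : ℝ → Prop) : ℕ → ℝ → Prop
  | 0 => P
  | k + 1 => fun t => cbl P k t ∧ ∀ ε : ℝ, 0 < ε → ∃ s, cbl P k s ∧ s ≠ t ∧ |s - t| < ε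

theorem cbl_sub {P : ℝ → Prop} : ∀ {k : ℕ} {t : ℝ}, cbl P k t → P t
  | 0, _, h => h
  | _ + 1, _, h => cbl_sub h.1

theorem cbl_local (P : ℝ → Prop) {V : Set ℝ} (hV : IsOpen V) (k : ℕ) :
    ∀ t, cbl (fun t => P t ∧ t ∈ V) k t ↔ cbl P k t ∧ t ∈ V := by
  induction k with
  | zero => intro t; rfl
  | succ k ih =>
    intro t
    simp only [cbl, ih]
    constructor
    · rintro ⟨⟨h1, h2⟩, h3⟩
      refine ⟨⟨h1, fun ε hε => ?_⟩, h2⟩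
      obtain ⟨s, hs, hs'⟩ := h3 ε hε
      exact ⟨s, hs.1, hs'⟩
    · rintro ⟨⟨h1, h2⟩, h3⟩
      refine ⟨⟨h1, h3⟩, fun ε hε => ?_⟩
      obtain ⟨δ, hδ, hb⟩ := Metric.isOpen_iff.1 hV t h3
      obtain ⟨s, hs, hs', hs''⟩ := h2 (min ε δ) (lt_min hε hδ)
      refine ⟨s, ⟨hs, hb ?_⟩, hs', lt_of_lt_of_le hs'' (min_le_left _ _)⟩
      rw [Metric.mem_ball, Real.dist_eq]
      exact lt_of_lt_of_le hs'' (min_le_right _ _)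

theorem cbl_empty : ∀ (N : ℕ) (P : ℝ → Prop) (D : Fin N → Set ℝ), (∀ i, IsDiscreteSet (D i)) →
    (∀ t, P t → ∃ i, t ∈ D i) → ∀ t, ¬ cbl P N t := by
  intro N
  induction N with
  | zero =>
    intro P D _ h t ht
    obtain ⟨i, _⟩ := h t ht
    exact i.elim0
  | succ N ih =>
    intro P D hD h t ht
    obtain ⟨j, hj⟩ := h t (cbl_sub ht)
    obtain ⟨U, hU, hUD⟩ := hD j t hj
    have htU : t ∈ U := by
      have : t ∈ U ∩ D j := by rw [hUD]; rfl
      exact this.1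
    have hV : IsOpen (U \ {t}) := hU.sdiff isClosed_singleton
    have key := ih (fun s => P s ∧ s ∈ U \ {t}) (fun i => D (j.succAbove i)) (fun i => hD _) ?_
    · obtain ⟨δ, hδ, hb⟩ := Metric.isOpen_iff.1 hU t htU
      obtain ⟨s, hs, hs', hs''⟩ := ht.2 δ hδ
      refine key s ((cbl_local P hV N s).2 ⟨hs, hb ?_, hs'⟩)
      rw [Metric.mem_ball, Real.dist_eq]
      exact hs''
    · rintro s ⟨hs, hsU, hst⟩
      obtain ⟨i, hi⟩ := h s hs
      have hij : i ≠ j := by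
        rintro rfl
        have : s ∈ U ∩ D i := ⟨hsU, hi⟩
        rw [hUD] at this
        exact hst this
      obtain ⟨i', rfl⟩ := Fin.exists_succAbove_eq hij
      exact ⟨i', hi⟩

variable {L} {X : Type} [Coo X]

def cb (A : X × ℝ → Prop) (k : ℕ) (p : X × ℝ) : Prop := cbl (fun t => A (p.1, t)) k p.2

/-- graph pieces -/
def GG (A : X × ℝ → Prop) (i : ℕ × ℚ × ℚ) (z : X × ℝ) : Prop :=
  cb A i.1 z ∧ (i.2.1 : ℝ) < z.2 ∧ z.2 < (i.2.2 : ℝ) ∧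
    ∀ s : ℝ, (i.2.1 : ℝ) < s → s < (i.2.2 : ℝ) → cb A i.1 (z.1, s) → s = z.2

theorem GG.sub {A : X × ℝ → Prop} {i : ℕ × ℚ × ℚ} {z : X × ℝ} (h : GG A i z) : A z :=
  cbl_sub h.1

theorem GG.func {A : X × ℝ → Prop} {i : ℕ × ℚ × ℚ} (x : X) (s t : ℝ) (h : GG A i (x, s))
    (h' : GG A i (x, t)) : s = t :=
  h'.2.2.2 s h.2.1 h.2.2.1 h.1

variable [hL : Fact (DMinimal L)]

theorem Dp.cb {A : X × ℝ → Prop} (hA : Dp L A) (k : ℕ) : Dp L (cb A k) := by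
  induction k with
  | zero => exact hA
  | succ k ih =>
    refine Dp.congr (P := fun p : X × ℝ => DMinPaper.cb A k p ∧ ∀ ε : ℝ, 0 < ε →
      ∃ s : ℝ, DMinPaper.cb A k (p.1, s) ∧ ¬ (s = p.2) ∧ |s - p.2| < ε) ?_ (fun p => Iff.rfl)
    refine ih.and (Dp.all (Dp.imp (Dp.lt ?_ ?_) (Dp.ex (Dp.and ?_ (Dp.and (Dp.not (Dp.eq ?_ ?_))
      (Dp.lt ?_ ?_))))))
    · fun_prop
    · fun_prop
    · exact ih.comp (f := fun q : ((X × ℝ) × ℝ) × ℝ => (q.1.1.1, q.2)) (by fun_prop)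
    all_goals fun_prop

theorem Dp.GG {A : X × ℝ → Prop} (hA : Dp L A) (i : ℕ × ℚ × ℚ) : Dp L (GG A i) := by
  have h := hA.cb i.1
  refine h.and (Dp.and (Dp.lt ?_ ?_) (Dp.and (Dp.lt ?_ ?_) (Dp.all (Dp.imp (Dp.lt ?_ ?_)
    (Dp.imp (Dp.lt ?_ ?_) (Dp.imp ?_ (Dp.eq ?_ ?_)))))))
  on_goal 9 => exact h.comp (f := fun q : (X × ℝ) × ℝ => (q.1.1, q.2)) (by fun_prop)
  all_goals fun_prop

theorem dec {A : X × ℝ → Prop} (hA : Dp L A) (x : X)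
    (hx : ∀ p q : ℝ, p < q → ∃ s, p < s ∧ s < q ∧ ¬ A (x, s)) (t : ℝ) (ht : A (x, t)) :
    ∃ i, GG A i (x, t) := by
  have hF : Dp L (fun t => A (x, t)) := hA.comp (f := fun t : ℝ => (x, t)) (by fun_prop)
  obtain ⟨N, U, D, hU, hD, hUD⟩ := dmin_line hF
  have hP : ∀ t, A (x, t) → ∃ i, t ∈ D i := by
    intro t ht
    have : t ∈ U ∪ ⋃ i, D i := by rw [← hUD]; exact ht
    rcases this with h | h
    · exfalso
      obtain ⟨δ, hδ, hb⟩ := Metric.isOpen_iff.1 hU t h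
      obtain ⟨s, h1, h2, h3⟩ := hx t (t + δ) (by linarith)
      apply h3
      have : s ∈ {t | A (x, t)} := by
        rw [hUD]
        left
        apply hb
        rw [Metric.mem_ball, Real.dist_eq, abs_lt]
        constructor <;> linarith
      exact this
    · exact Set.mem_iUnion.1 h
  have hN : ∃ n, ¬ cbl (fun t => A (x, t)) n t := ⟨N, cbl_empty N _ D hD hP t⟩
  have hk := Nat.find_spec hN
  have hmin := fun m => Nat.find_min (H := hN) (m := m)
  rcases hkk : Nat.find hN with _ | k
  · rw [hkk] at hk; exact absurd ht hk
  · rw [hkk] at hk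
    have hk' : cbl (fun t => A (x, t)) k t := not_not.1 (hmin k (by omega))
    have : ∃ ε : ℝ, 0 < ε ∧ ∀ s, cbl (fun t => A (x, t)) k s → s ≠ t → ¬ |s - t| < ε := by
      by_contra hcon
      push Not at hcon
      exact hk ⟨hk', hcon⟩
    obtain ⟨ε, hε, hs⟩ := this
    obtain ⟨p, hp1, hp2⟩ := exists_rat_btwn (show t - ε < t by linarith)
    obtain ⟨q, hq1, hq2⟩ := exists_rat_btwn (show t < t + ε by linarith)
    refine ⟨(k, p, q), hk', hp2, hq1, fun s h1 h2 h3 => ?_⟩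
    by_contra hne
    refine hs s h3 hne ?_
    simp only at h1 h2
    rw [abs_lt]
    constructor <;> linarith

end Decomp

section Category

variable {L} {X : Type} [Coo X] [TopologicalSpace X]

variable (L X) in
def Good : Prop := ∀ A : X → Prop, Dp L A → IsMeagre ({x | A x} \ interior {x | A x})

theorem Good.key [BaireSpace X] (hX : Good L X) {I : Type} [Countable I] {A : I → X → Prop}
    (hA : ∀ i, Dp L (A i)) {U : Set X} (hU : IsOpen U) (hne : U.Nonempty)
    (hcov : ∀ x ∈ U, ∃ i, A i x) : ∃ i, (U ∩ interior {x | A i x}).Nonempty := by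
  by_contra hcon
  push Not at hcon
  refine not_isMeagre_of_isOpen hU hne ?_
  refine (isMeagre_iUnion fun i => hX (A i) (hA i)).mono ?_
  intro x hx
  obtain ⟨i, hi⟩ := hcov x hx
  refine Set.mem_iUnion.2 ⟨i, hi, fun h => ?_⟩
  have : x ∈ U ∩ interior {x | A i x} := ⟨hx, h⟩
  rw [hcon i] at this
  exact this

variable [hL : Fact (DMinimal L)]

theorem Good.graph [BaireSpace X] (hX : Good L X) {G : X × ℝ → Prop} (hG : Dp L G)
    (hf : ∀ x s t, G (x, s) → G (x, t) → s = t) : IsMeagre {z | G z} := by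
  apply IsNowhereDense.isMeagre
  rw [IsNowhereDense]
  by_contra hne
  obtain ⟨⟨x0, t0⟩, hz⟩ := Set.nonempty_iff_ne_empty.2 hne
  obtain ⟨U, V, hU, hx0, hV, ht0, hUV⟩ : ∃ (U : Set X) (V : Set ℝ), IsOpen U ∧ x0 ∈ U ∧
      IsOpen V ∧ t0 ∈ V ∧ U ×ˢ V ⊆ interior (closure {z | G z}) := by
    obtain ⟨U, V, hU, hV, h1, h2, h3⟩ := isOpen_prod_iff.1 isOpen_interior x0 t0 hz
    exact ⟨U, V, hU, h1, hV, h2, h3⟩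
  obtain ⟨δ, hδ, hb⟩ := Metric.isOpen_iff.1 hV t0 ht0
  let A : Fin 3 → X → Prop := ![fun x => ∃ t, t0 < t ∧ G (x, t), fun x => ∃ t, t ≤ t0 ∧ G (x, t),
    fun x => ¬ ∃ t, G (x, t)]
  have hGc : Dp L (fun p : X × ℝ => G (p.1, p.2)) := hG
  have hA : ∀ i, Dp L (A i) := by
    intro i
    fin_cases i
    · exact Dp.ex (Dp.and (Dp.lt (by fun_prop) (by fun_prop)) hGc)
    · exact Dp.ex (Dp.and (Dp.le (by fun_prop) (by fun_prop)) hGc)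
    · exact Dp.not (Dp.ex hGc)
  have hcov : ∀ x ∈ U, ∃ i, A i x := by
    intro x _
    by_cases h : ∃ t, G (x, t)
    · obtain ⟨t, ht⟩ := h
      rcases lt_or_ge t0 t with h | h
      · exact ⟨0, t, h, ht⟩
      · exact ⟨1, t, h, ht⟩
    · exact ⟨2, h⟩
  -- a general contradiction
  have contra : ∀ (B : X → Prop) (a b : ℝ), a < b → Set.Ioo a b ⊆ V →
      (U ∩ interior {x | B x}).Nonempty → (∀ x t, B x → a < t → t < b → ¬ G (x, t)) → False := by
    intro B a b hab habV hn hB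
    obtain ⟨x1, hx1⟩ := hn
    obtain ⟨t1, ht1, ht1'⟩ := exists_between hab
    have hcl : (x1, t1) ∈ closure {z | G z} :=
      interior_subset (hUV ⟨hx1.1, habV ⟨ht1, ht1'⟩⟩)
    have hopen : IsOpen ((U ∩ interior {x | B x}) ×ˢ Set.Ioo a b) :=
      (hU.inter isOpen_interior).prod isOpen_Ioo
    obtain ⟨⟨x2, t2⟩, h2, h2'⟩ := mem_closure_iff.1 hcl _ hopen ⟨hx1, ht1, ht1'⟩
    exact hB x2 t2 (interior_subset h2.1.2) h2.2.1 h2.2.2 h2'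
  have sub1 : Set.Ioo (t0 - δ) t0 ⊆ V := fun s hs => hb (by
    rw [Metric.mem_ball, Real.dist_eq, abs_lt]; constructor <;> linarith [hs.1, hs.2])
  have sub2 : Set.Ioo t0 (t0 + δ) ⊆ V := fun s hs => hb (by
    rw [Metric.mem_ball, Real.dist_eq, abs_lt]; constructor <;> linarith [hs.1, hs.2])
  obtain ⟨i, hi⟩ := hX.key hA hU ⟨x0, hx0⟩ hcov
  fin_cases i
  · refine contra _ _ _ (by linarith) sub1 hi ?_
    rintro x t ⟨s, hs, hG'⟩ h1 h2 h3
    have := hf x s t hG' h3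
    linarith
  · refine contra _ _ _ (by linarith) sub2 hi ?_
    rintro x t ⟨s, hs, hG'⟩ h1 h2 h3
    have := hf x s t hG' h3
    linarith
  · refine contra _ _ _ (by linarith) sub2 hi ?_
    intro x t h h1 h2 h3
    exact h ⟨t, h3⟩

theorem Good.succ [BaireSpace X] (hX : Good L X) : Good L (X × ℝ) := by
  intro A hA
  let W : ℚ × ℚ → X → Prop := fun r x => ∀ s : ℝ, (r.1 : ℝ) < s → s < (r.2 : ℝ) → A (x, s)
  have hW : ∀ r, Dp L (W r) := fun r => by
    refine Dp.all (Dp.imp (Dp.lt ?_ ?_) (Dp.imp (Dp.lt ?_ ?_) hA)) <;> fun_prop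
  let B : X × ℝ → Prop := fun z => A z ∧ ∀ p q : ℝ, p < z.2 → z.2 < q →
    ∃ s : ℝ, p < s ∧ s < q ∧ ¬ A (z.1, s)
  have hB : Dp L B := by
    refine hA.and (Dp.all (Dp.all (Dp.imp (Dp.lt ?_ ?_) (Dp.imp (Dp.lt ?_ ?_)
      (Dp.ex (Dp.and (Dp.lt ?_ ?_) (Dp.and (Dp.lt ?_ ?_) (Dp.not ?_))))))))
    on_goal 9 => exact hA.comp (f := fun q : (((X × ℝ) × ℝ) × ℝ) × ℝ => (q.1.1.1.1, q.2)) (by fun_prop)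
    all_goals fun_prop
  have hB' : ∀ x, ∀ p q : ℝ, p < q → ∃ s, p < s ∧ s < q ∧ ¬ B (x, s) := by
    intro x p q hpq
    by_contra hcon
    push Not at hcon
    obtain ⟨t, ht, ht'⟩ := exists_between hpq
    obtain ⟨s, hs, hs', hs''⟩ := (hcon t ht ht').2 p q ht ht'
    exact hs'' (hcon s hs hs').1
  have m1 : IsMeagre (⋃ r, (Prod.fst : X × ℝ → X) ⁻¹' ({x | W r x} \ interior {x | W r x})) :=
    isMeagre_iUnion fun r => (hX _ (hW r)).preimage_of_isOpenMap continuous_fst isOpenMap_fst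
  have m2 : IsMeagre (⋃ i, {z | GG B i z}) :=
    isMeagre_iUnion fun i => hX.graph (hB.GG i) GG.func
  refine (m1.union m2).mono ?_
  rintro ⟨x, t⟩ ⟨hz, hzi⟩
  by_cases hb : B (x, t)
  · right
    exact Set.mem_iUnion.2 (dec hB x (hB' x) t hb)
  · left
    have : ∃ p q : ℝ, p < t ∧ t < q ∧ ∀ s : ℝ, p < s → s < q → A (x, s) := by
      by_contra hcon
      push Not at hcon
      exact hb ⟨hz, hcon⟩
    obtain ⟨p', q', hp, hq, hs⟩ := this
    obtain ⟨p, hp1, hp2⟩ := exists_rat_btwn hp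
    obtain ⟨q, hq1, hq2⟩ := exists_rat_btwn hq
    refine Set.mem_iUnion.2 ⟨(p, q), fun s h1 h2 => hs s (hp1.trans h1) (h2.trans hq2), ?_⟩
    intro hint
    apply hzi
    have hopen : IsOpen (interior {x | W (p, q) x} ×ˢ Set.Ioo (p : ℝ) (q : ℝ)) :=
      isOpen_interior.prod isOpen_Ioo
    refine interior_maximal ?_ hopen ⟨hint, hp2, hq1⟩
    rintro ⟨x', t'⟩ ⟨h1, h2, h3⟩
    exact interior_subset h1 t' h2 h3

theorem Good.transfer {Y : Type} [Coo Y] [TopologicalSpace Y] (hX : Good L X) (h : X ≃ₜ Y)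
    (hp : DM L (h : X → Y)) : Good L Y := by
  intro A hA
  have := (hX _ (hA.comp hp)).preimage_of_isOpenMap h.symm.continuous h.symm.isOpenMap
  convert this using 1
  have e : {x | A (h x)} = h ⁻¹' {y | A y} := rfl
  rw [e, ← h.preimage_interior, Set.preimage_sdiff]
  ext y
  simp

variable (L) in
theorem good_pi (n : ℕ) : Good L (Fin n → ℝ) := by
  induction n with
  | zero =>
    intro A _
    have : {x | A x} \ interior {x | A x} = ∅ := by
      rw [(isOpen_discrete _).interior_eq, Set.sdiff_self]
    rw [this]
    exact IsMeagre.empty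
  | succ n ih =>
    refine ih.succ.transfer ((Homeomorph.prodComm _ _).trans (Fin.consEquivL ℝ (fun _ : Fin (n+1) => ℝ)).toHomeomorph) ?_
    refine DM.pi fun i => ?_
    refine Fin.cases ?_ (fun j => ?_) i
    · change DM L (fun x : (Fin n → ℝ) × ℝ => x.2)
      fun_prop
    · change DM L (fun x : (Fin n → ℝ) × ℝ => x.1 j)
      fun_prop

variable (L) in
theorem good_real : Good L ℝ := by
  refine (good_pi L 1).transfer (Homeomorph.funUnique (Fin 1) ℝ) ?_
  change DM L (fun x : Fin 1 → ℝ => x 0)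
  fun_prop

end Category

theorem int_sub {X : Type} [TopologicalSpace X] {P : X → Prop} {x : X}
    (h : x ∈ interior {x | P x}) : P x := interior_subset (s := {x | P x}) h

section OneVar

variable {L} [hL : Fact (DMinimal L)]

theorem cont_piece {v : ℝ → ℝ} (hv : DM L v) {J : Set ℝ} (hJ : IsOpen J) (hne : J.Nonempty) :
    ∃ c d, c < d ∧ Set.Icc c d ⊆ J ∧ ContinuousOn v (Set.Icc c d) := by
  let C : ℝ → Prop := fun y => ∀ ε : ℝ, 0 < ε → ∃ δ : ℝ, 0 < δ ∧ ∀ y' : ℝ, |y' - y| < δ →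
    |v y' - v y| < ε
  have hC : Dp L C := by
    refine Dp.all (Dp.imp (Dp.lt ?_ ?_) (Dp.ex (Dp.and (Dp.lt ?_ ?_) (Dp.all (Dp.imp (Dp.lt ?_ ?_)
      (Dp.lt ?_ ?_)))))) <;> fun_prop
  have hlt : ∀ r : ℚ, Dp L (fun y : ℝ => v y < (r : ℝ)) := fun r => Dp.lt hv (by fun_prop)
  have hgt : ∀ r : ℚ, Dp L (fun y : ℝ => (r : ℝ) < v y) := fun r => Dp.lt (by fun_prop) hv
  have hG := good_real L
  have hn : (J ∩ interior {y | C y}).Nonempty := by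
    by_contra hcon
    refine not_isMeagre_of_isOpen hJ hne ?_
    refine (((hG _ hC).union (isMeagre_iUnion fun r => hG _ (hlt r))).union
      (isMeagre_iUnion fun r => hG _ (hgt r))).mono ?_
    intro y hy
    by_contra hny
    simp only [Set.mem_union, Set.mem_iUnion, not_or, not_exists] at hny
    obtain ⟨⟨h1, h2⟩, h3⟩ := hny
    have hCy : C y := by
      intro ε hε
      obtain ⟨r, hr1, hr2⟩ := exists_rat_btwn (show v y - ε < v y by linarith)
      obtain ⟨q, hq1, hq2⟩ := exists_rat_btwn (show v y < v y + ε by linarith)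
      have m1 : y ∈ interior {y | v y < (q : ℝ)} := by
        by_contra h; exact h2 q ⟨hq1, h⟩
      have m2 : y ∈ interior {y | (r : ℝ) < v y} := by
        by_contra h; exact h3 r ⟨hr2, h⟩
      obtain ⟨δ, hδ, hb⟩ := Metric.isOpen_iff.1 (isOpen_interior.inter isOpen_interior) y ⟨m1, m2⟩
      refine ⟨δ, hδ, fun y' hy' => ?_⟩
      have := hb (show y' ∈ Metric.ball y δ by rwa [Metric.mem_ball, Real.dist_eq])
      have e1 : v y' < q := int_sub (P := fun y => v y < (q:ℝ)) this.1
      have e2 : (r : ℝ) < v y' := int_sub (P := fun y => (r:ℝ) < v y) this.2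
      rw [abs_lt]
      constructor <;> linarith
    refine h1 ⟨hCy, fun h => hcon ⟨y, hy, h⟩⟩
  obtain ⟨y, hy⟩ := hn
  obtain ⟨δ, hδ, hb⟩ := Metric.isOpen_iff.1 (hJ.inter isOpen_interior) y hy
  have hsub : Set.Icc y (y + δ / 2) ⊆ J ∩ interior {y | C y} := by
    intro z hz
    apply hb
    rw [Metric.mem_ball, Real.dist_eq, abs_lt]
    constructor <;> linarith [hz.1, hz.2]
  refine ⟨y, y + δ / 2, by linarith, fun z hz => (hsub hz).1, ?_⟩
  intro z hz
  apply ContinuousAt.continuousWithinAt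
  rw [Metric.continuousAt_iff]
  have hCz : C z := interior_subset (hsub hz).2
  intro ε hε
  obtain ⟨η, h1, h2⟩ := hCz ε hε
  exact ⟨η, h1, fun {x} hx => h2 x hx⟩

theorem mono_piece {u : ℝ → ℝ} (hu : DM L u) {a b : ℝ} (hab : a < b) :
    ∃ c d, c < d ∧ a ≤ c ∧ d ≤ b ∧ (MonotoneOn u (Set.Ioo c d) ∨ AntitoneOn u (Set.Ioo c d)) := by
  let A : ℝ × ℝ → Prop := fun z => u z.2 = z.1 ∧ a < z.2 ∧ z.2 < b
  have hA : Dp L A := by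
    refine Dp.and (Dp.eq ?_ ?_) (Dp.and (Dp.lt ?_ ?_) (Dp.lt ?_ ?_)) <;> fun_prop
  -- constant case
  have hconst : ∀ y p q, p < q → (∀ s, p < s → s < q → A (y, s)) → 
      ∃ c d, c < d ∧ a ≤ c ∧ d ≤ b ∧
        (MonotoneOn u (Set.Ioo c d) ∨ AntitoneOn u (Set.Ioo c d)) := by
    intro y p q hpq h
    obtain ⟨c, hc1, hc2⟩ := exists_between hpq
    obtain ⟨d, hd1, hd2⟩ := exists_between hc2
    refine ⟨c, d, hd1, (h c hc1 hc2).2.1.le, (h d (hc1.trans hd1) hd2).2.2.le, Or.inl ?_⟩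
    intro s hs t ht _
    have e1 := (h s (hc1.trans hs.1) (hs.2.trans hd2)).1
    have e2 := (h t (hc1.trans ht.1) (ht.2.trans hd2)).1
    simp only at e1 e2
    rw [e1, e2]
  by_cases hcase : ∃ y p q, p < q ∧ ∀ s, p < s → s < q → A (y, s)
  · obtain ⟨y, p, q, h1, h2⟩ := hcase
    exact hconst y p q h1 h2
  push Not at hcase
  have hdec : ∀ t, a < t → t < b → ∃ i, GG A i (u t, t) := fun t h1 h2 =>
    dec hA (u t) (fun p q hpq => hcase _ p q hpq) t ⟨rfl, h1, h2⟩
  -- range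
  let R : ℝ → Prop := fun y => ∃ t, A (y, t)
  have hR : Dp L R := Dp.ex hA
  by_cases hRi : (interior {y | R y}).Nonempty
  · have hcov : ∀ y ∈ interior {y | R y}, ∃ i, ∃ t, GG A i (y, t) := by
      intro y hy
      obtain ⟨t, ht⟩ : R y := int_sub hy
      obtain ⟨i, hi⟩ := hdec t ht.2.1 ht.2.2
      have : u t = y := ht.1
      rw [this] at hi
      exact ⟨i, t, hi⟩
    obtain ⟨i, hi⟩ := (good_real L).key (fun i => Dp.ex (P := fun y t => GG A i (y, t)) (hA.GG i))
      isOpen_interior hRi hcov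
    obtain ⟨v, hv, hvG⟩ := exists_fun (hA.GG i) GG.func
    obtain ⟨c, d, hcd, hsub, hcont⟩ := cont_piece hv (isOpen_interior.inter isOpen_interior) hi
    have hvA : ∀ y ∈ Set.Icc c d, A (y, v y) := by
      intro y hy
      obtain ⟨t, ht⟩ : ∃ t, GG A i (y, t) := int_sub (P := fun y => ∃ t, GG A i (y, t)) (hsub hy).2
      rw [hvG y t ht]
      exact ht.sub
    have hinj : Set.InjOn v (Set.Icc c d) := by
      intro y hy z hz hyz
      have e1 := (hvA y hy).1
      have e2 := (hvA z hz).1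
      simp only at e1 e2
      rw [← e1, ← e2, hyz]
    have hc : c ∈ Set.Icc c d := ⟨le_rfl, hcd.le⟩
    have hd : d ∈ Set.Icc c d := ⟨hcd.le, le_rfl⟩
    rcases hcont.strictMonoOn_of_injOn_Icc' hcd.le hinj with hm | hm
    · refine ⟨v c, v d, hm hc hd hcd, (hvA c hc).2.1.le, (hvA d hd).2.2.le, Or.inl ?_⟩
      intro s hs t ht hst
      obtain ⟨y, hy, rfl⟩ := intermediate_value_Icc hcd.le hcont ⟨hs.1.le, hs.2.le⟩
      obtain ⟨z, hz, rfl⟩ := intermediate_value_Icc hcd.le hcont ⟨ht.1.le, ht.2.le⟩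
      have e1 := (hvA y hy).1
      have e2 := (hvA z hz).1
      simp only at e1 e2
      rw [e1, e2]
      exact (hm.le_iff_le hy hz).1 hst
    · refine ⟨v d, v c, hm hc hd hcd, (hvA d hd).2.1.le, (hvA c hc).2.2.le, Or.inr ?_⟩
      intro s hs t ht hst
      obtain ⟨y, hy, rfl⟩ := intermediate_value_Icc' hcd.le hcont ⟨hs.1.le, hs.2.le⟩
      obtain ⟨z, hz, rfl⟩ := intermediate_value_Icc' hcd.le hcont ⟨ht.1.le, ht.2.le⟩
      have e1 := (hvA y hy).1
      have e2 := (hvA z hz).1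
      simp only at e1 e2
      rw [e1, e2]
      exact (hm.le_iff_ge hy hz).1 hst
  · -- countable range
    let B : ℝ × ℝ → Prop := fun z => R z.2
    have hB : Dp L B := hR.comp (f := fun z : ℝ × ℝ => z.2) (by fun_prop)
    have hB' : ∀ p q : ℝ, p < q → ∃ s, p < s ∧ s < q ∧ ¬ B (0, s) := by
      intro p q hpq
      by_contra hcon
      push Not at hcon
      apply hRi
      obtain ⟨t, ht, ht'⟩ := exists_between hpq
      exact ⟨t, interior_maximal (fun s hs => hcon s hs.1 hs.2) isOpen_Ioo ⟨ht, ht'⟩⟩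
    obtain ⟨i, x, hx1, hx2⟩ := (good_real L).key (I := ℕ × ℚ × ℚ)
      (A := fun i t => (a < t ∧ t < b) ∧ GG B i (0, u t))
      (fun i => by
        refine Dp.and (Dp.and (Dp.lt ?_ ?_) (Dp.lt ?_ ?_)) ?_
        on_goal 5 => exact (hB.GG i).comp (f := fun t : ℝ => ((0 : ℝ), u t)) (by fun_prop)
        all_goals fun_prop)
      isOpen_Ioo (Set.nonempty_Ioo.2 hab)
      (fun t ht => by
        obtain ⟨i, hi⟩ := dec hB 0 hB' (u t) ⟨t, rfl, ht.1, ht.2⟩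
        exact ⟨i, ⟨ht.1, ht.2⟩, hi⟩)
    obtain ⟨δ, hδ, hb⟩ := Metric.isOpen_iff.1 isOpen_interior x hx2
    refine hconst (u x) x (x + δ) (by linarith) fun s hs1 hs2 => ?_
    have hs : s ∈ {t | (a < t ∧ t < b) ∧ GG B i (0, u t)} := by
      apply interior_subset
      apply hb
      rw [Metric.mem_ball, Real.dist_eq, abs_lt]
      constructor <;> linarith
    exact ⟨GG.func _ _ _ hs.2 (interior_subset hx2).2, hs.1⟩

theorem lip_point {u : ℝ → ℝ} (hu : DM L u) {a b : ℝ} (hab : a < b) :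
    ∃ t, a < t ∧ t < b ∧ ∃ K : ℝ, 0 < K ∧ ∀ s, |s| * K < 1 → |u (t + s) - u t| ≤ K * |s| := by
  obtain ⟨c, d, hcd, hac, hdb, hm⟩ := mono_piece hu hab
  have hae : ∀ᵐ x, x ∈ Set.Ioo c d → DifferentiableWithinAt ℝ u (Set.Ioo c d) x := by
    rcases hm with hm | hm
    · exact hm.ae_differentiableWithinAt_of_mem
    · have := hm.neg.ae_differentiableWithinAt_of_mem
      filter_upwards [this] with x hx hx'
      have := (hx hx').neg
      simpa using this
  have hpos : MeasureTheory.volume (Set.Ioo c d) ≠ 0 := by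
    rw [Real.volume_Ioo]
    simpa using hcd
  obtain ⟨t, ht, htd⟩ : ∃ t ∈ Set.Ioo c d, DifferentiableWithinAt ℝ u (Set.Ioo c d) t := by
    by_contra hcon
    push Not at hcon
    apply hpos
    refine MeasureTheory.measure_mono_null ?_ hae
    intro x hx h
    exact hcon x hx (h hx)
  have hdiff : DifferentiableAt ℝ u t := htd.differentiableAt (Ioo_mem_nhds ht.1 ht.2)
  obtain ⟨C, hC⟩ := hdiff.isBigO_sub.bound
  obtain ⟨δ, hδ, hb⟩ := Metric.eventually_nhds_iff.1 hC
  refine ⟨t, lt_of_le_of_lt hac ht.1, lt_of_lt_of_le ht.2 hdb, |C| + δ⁻¹, by positivity, ?_⟩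
  intro s hs
  have hsδ : |s| < δ := by
    have h1 : |s| * δ⁻¹ < 1 := by
      have : 0 ≤ |s| * |C| := by positivity
      linarith [mul_add |s| |C| δ⁻¹]
    rwa [← div_eq_mul_inv, div_lt_one hδ] at h1
  have h2 := hb (y := t + s) (by rw [Real.dist_eq]; simpa using hsδ)
  simp only [Real.norm_eq_abs, add_sub_cancel_left] at h2
  refine h2.trans (mul_le_mul_of_nonneg_right ?_ (abs_nonneg _))
  have : 0 < δ⁻¹ := by positivity
  linarith [le_abs_self C]

end OneVar

section Several

variable {L} [hL : Fact (DMinimal L)]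

def shift {n : ℕ} (x : Fin n → ℝ) (i : Fin n) (s : ℝ) : Fin n → ℝ :=
  fun j => x j + if j = i then s else 0

theorem DM.shift {n : ℕ} {X : Type} [Coo X] {f : X → Fin n → ℝ} {g : X → ℝ} (i : Fin n)
    (hf : DM L f) (hg : DM L g) : DM L (fun z => shift (f z) i (g z)) := by
  refine DM.pi fun j => ?_
  unfold DMinPaper.shift
  have h1 : DM L (fun z => f z j) := (DM.ev j).comp' hf
  by_cases h : j = i
  · simp only [h, if_true] at h1 ⊢
    exact h1.add hg
  · simp only [h, if_false]
    exact h1.add (DM.const' 0)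

def Lset {n : ℕ} (h : (Fin n → ℝ) → ℝ) (i : Fin n) (K : ℝ) (x : Fin n → ℝ) : Prop :=
  ∀ s : ℝ, |s| * K < 1 → |h (shift x i s) - h x| ≤ K * |s|

theorem Lset.mono {n : ℕ} {h : (Fin n → ℝ) → ℝ} {i : Fin n} {K K' : ℝ} (hK : K ≤ K')
    {x : Fin n → ℝ} (hx : Lset h i K x) : Lset h i K' x := fun s hs =>
  (hx s (lt_of_le_of_lt (mul_le_mul_of_nonneg_left hK (abs_nonneg _)) hs)).trans
    (mul_le_mul_of_nonneg_right hK (abs_nonneg _))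

theorem Dp.Lset2 {n : ℕ} {h : (Fin n → ℝ) → ℝ} (hh : DM L h) (i : Fin n) :
    Dp L (fun p : (Fin n → ℝ) × ℝ => Lset h i p.2 p.1) := by
  have h1 : DM L (fun q : ((Fin n → ℝ) × ℝ) × ℝ => h (shift q.1.1 i q.2)) :=
    hh.comp' (DM.shift i (by fun_prop) (by fun_prop))
  refine Dp.all (Dp.imp (Dp.lt ?_ ?_) (Dp.le ?_ ?_))
  · fun_prop
  · fun_prop
  · exact (h1.sub (hh.comp' (f := fun q : ((Fin n → ℝ) × ℝ) × ℝ => q.1.1) (by fun_prop))).abs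
  · fun_prop

theorem lip_box {n : ℕ} {h : (Fin n → ℝ) → ℝ} (hh : DM L h) (i : Fin n) {U : Set (Fin n → ℝ)}
    (hU : IsOpen U) (hne : U.Nonempty) :
    ∃ V ⊆ U, IsOpen V ∧ V.Nonempty ∧ ∃ K : ℕ, ∀ x ∈ V, Lset h i K x := by
  have h2 := Dp.Lset2 hh i
  let A : Option ℕ → (Fin n → ℝ) → Prop := fun o => o.elim
    (fun x => ¬ ∃ K : ℝ, 0 < K ∧ Lset h i K x) (fun K x => Lset h i K x)
  have hA : ∀ o, Dp L (A o) := by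
    rintro (_ | K)
    · exact Dp.not (Dp.ex (Dp.and (Dp.lt (by fun_prop) (by fun_prop)) h2))
    · exact h2.comp (f := fun x : Fin n → ℝ => (x, (K : ℝ))) (by fun_prop)
  have hcov : ∀ x ∈ U, ∃ o, A o x := by
    intro x _
    by_cases hx : ∃ K : ℝ, 0 < K ∧ Lset h i K x
    · obtain ⟨K, _, hK⟩ := hx
      obtain ⟨N, hN⟩ := exists_nat_ge K
      exact ⟨some N, hK.mono hN⟩
    · exact ⟨none, hx⟩
  obtain ⟨o, ho⟩ := (good_pi L n).key hA hU hne hcov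
  rcases o with _ | K
  · exfalso
    obtain ⟨x, _, hx⟩ := ho
    obtain ⟨δ, hδ, hb⟩ := Metric.isOpen_iff.1 isOpen_interior x hx
    have hu : DM L (fun s : ℝ => h (shift x i s)) :=
      hh.comp' (DM.shift i (by fun_prop) (by fun_prop))
    obtain ⟨t, ht1, ht2, K, hK, hs⟩ := lip_point hu (show -δ < δ by linarith)
    have hmem : shift x i t ∈ interior {x | A none x} := by
      apply hb
      rw [Metric.mem_ball, dist_pi_lt_iff hδ]
      intro j
      rw [Real.dist_eq]
      unfold shift
      split_ifs
      · rw [add_sub_cancel_left, abs_lt]; exact ⟨ht1, ht2⟩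
      · simpa using hδ
    refine (int_sub hmem : A none _) ⟨K, hK, fun s hs' => ?_⟩
    have := hs s hs'
    have e : shift (shift x i t) i s = shift x i (t + s) := by
      funext j
      unfold shift
      split_ifs <;> ring
    rw [e]
    exact this
  · exact ⟨_, Set.inter_subset_left, hU.inter isOpen_interior, ho, K, fun x hx => int_sub hx.2⟩

theorem lip_box_fin {n : ℕ} {I : Type} (F : Finset (I × Fin n)) (g : I → (Fin n → ℝ) → ℝ)
    (hg : ∀ j, DM L (g j)) {U : Set (Fin n → ℝ)} (hU : IsOpen U) (hne : U.Nonempty) :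
    ∃ V ⊆ U, IsOpen V ∧ V.Nonempty ∧ ∃ K : ℕ, ∀ p ∈ F, ∀ x ∈ V, Lset (g p.1) p.2 K x := by
  induction F using Finset.induction_on with
  | empty => exact ⟨U, subset_rfl, hU, hne, 0, by simp⟩
  | insert a F _ ih =>
    obtain ⟨V, hVU, hV, hVn, K, hK⟩ := ih
    obtain ⟨W, hWV, hW, hWn, K', hK'⟩ := lip_box (hg a.1) a.2 hV hVn
    refine ⟨W, hWV.trans hVU, hW, hWn, max K K', fun p hp x hx => ?_⟩
    rcases Finset.mem_insert.1 hp with rfl | hp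
    · exact (hK' x hx).mono (by exact_mod_cast le_max_right _ _)
    · exact (hK p hp x (hWV hx)).mono (by exact_mod_cast le_max_left _ _)

theorem lip_ball {n : ℕ} {h : (Fin n → ℝ) → ℝ} {x0 : Fin n → ℝ} {r : ℝ} {K : ℕ} (hr : 0 < r)
    (hrK : 2 * r * K < 1) (hl : ∀ i, ∀ x ∈ Metric.ball x0 r, Lset h i K x) {x y : Fin n → ℝ}
    (hx : x ∈ Metric.ball x0 r) (hy : y ∈ Metric.ball x0 r) :
    |h y - h x| ≤ n * K * dist y x := by
  have hxj : ∀ j, dist (x j) (x0 j) < r := (dist_pi_lt_iff hr).1 hx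
  have hyj : ∀ j, dist (y j) (x0 j) < r := (dist_pi_lt_iff hr).1 hy
  let z : ℕ → Fin n → ℝ := fun k j => if (j : ℕ) < k then y j else x j
  have hz : ∀ k, z k ∈ Metric.ball x0 r := by
    intro k
    rw [Metric.mem_ball, dist_pi_lt_iff hr]
    intro j
    simp only [z]
    split_ifs
    · exact hyj j
    · exact hxj j
  have key : ∀ k, k ≤ n → |h (z k) - h x| ≤ k * (K * dist y x) := by
    intro k
    induction k with
    | zero => intro _; simp [z]
    | succ k ih =>
      intro hk
      have h1 := ih (by omega)
      let i : Fin n := ⟨k, hk⟩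
      have e : z (k + 1) = shift (z k) i (y i - x i) := by
        funext j
        simp only [z, shift]
        by_cases hj : j = i
        · subst hj; simp [i]
        · have : (j : ℕ) ≠ k := fun h => hj (Fin.ext h)
          have : ((j : ℕ) < k + 1) ↔ (j : ℕ) < k := by omega
          simp [hj, this]
      have hd : |y i - x i| ≤ dist y x := dist_le_pi_dist y x i
      have hd2 : |y i - x i| < 2 * r := by
        have := dist_triangle_right (y i) (x i) (x0 i)
        have e' : dist (y i) (x i) = |y i - x i| := rfl
        linarith [hyj i, hxj i]
      have h2 := hl i (z k) (hz k) (y i - x i)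
        (lt_of_le_of_lt (mul_le_mul_of_nonneg_right hd2.le (Nat.cast_nonneg _)) hrK)
      rw [← e] at h2
      have h3 : (K : ℝ) * |y i - x i| ≤ K * dist y x :=
        mul_le_mul_of_nonneg_left hd (Nat.cast_nonneg _)
      have h4 := abs_sub_le (h (z (k + 1))) (h (z k)) (h x)
      push_cast
      linarith [add_mul (k : ℝ) 1 (K * dist y x)]
  have := key n le_rfl
  have e : z n = y := by funext j; simp [z]
  rw [e] at this
  linarith [mul_assoc (n : ℝ) K (dist y x)]

theorem exists_diff {n m : ℕ} (g : Fin m → (Fin n → ℝ) → ℝ) (hg : ∀ j, DM L (g j))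
    {U : Set (Fin n → ℝ)} (hU : IsOpen U) (hne : U.Nonempty) :
    ∃ y ∈ U, DifferentiableAt ℝ (fun y => fun j => g j y) y := by
  obtain ⟨V, hVU, hV, ⟨x0, hx0⟩, K, hK⟩ := lip_box_fin Finset.univ g hg hU hne
  obtain ⟨δ, hδ, hb⟩ := Metric.isOpen_iff.1 hV x0 hx0
  obtain ⟨r, hr, hr1, hr2⟩ : ∃ r : ℝ, 0 < r ∧ r ≤ δ ∧ 2 * r * K < 1 := by
    refine ⟨min δ (1 / (2 * (K + 1))), by positivity, min_le_left _ _, ?_⟩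
    have h1 : min δ (1 / (2 * ((K : ℝ) + 1))) ≤ 1 / (2 * (K + 1)) := min_le_right _ _
    have h2 : 2 * (1 / (2 * ((K : ℝ) + 1))) * K < 1 := by
      rw [show 2 * (1 / (2 * ((K : ℝ) + 1))) * K = K / (K + 1) by field_simp]
      rw [div_lt_one (by positivity)]
      linarith
    refine lt_of_le_of_lt ?_ h2
    gcongr
  have hsub : Metric.ball x0 r ⊆ V := (Metric.ball_subset_ball hr1).trans hb
  have hlip : LipschitzOnWith (n * K : ℕ) (fun y => fun j => g j y) (Metric.ball x0 r) := by
    refine LipschitzOnWith.of_dist_le_mul fun x hx y hy => ?_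
    rw [dist_pi_le_iff (by positivity)]
    intro j
    have := lip_ball (h := g j) hr hr2 (fun i x hx => hK (j, i) (Finset.mem_univ _) x (hsub hx)) hy hx
    rw [Real.dist_eq]
    push_cast
    exact this
  have hae := hlip.ae_differentiableWithinAt_of_mem (μ := MeasureTheory.volume)
  have hpos : MeasureTheory.volume (Metric.ball x0 r) ≠ 0 :=
    (Metric.measure_ball_pos _ _ hr).ne'
  by_contra hcon
  push Not at hcon
  apply hpos
  refine MeasureTheory.measure_mono_null ?_ hae
  intro x hx h
  exact hcon x (hVU (hsub hx)) ((h hx).differentiableAt (Metric.isOpen_ball.mem_nhds hx))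

/-- one-dimensional local definable sections -/
theorem section_one {n : ℕ} {A : (Fin n → ℝ) × ℝ → Prop} (hA : Dp L A) {U : Set (Fin n → ℝ)}
    (hU : IsOpen U) (hne : U.Nonempty) (hc : ∀ y ∈ U, ∃ t, A (y, t)) :
    ∃ V ⊆ U, IsOpen V ∧ V.Nonempty ∧ ∃ g : (Fin n → ℝ) → ℝ, DM L g ∧ ∀ y ∈ V, A (y, g y) := by
  let B : ℚ ⊕ (ℕ × ℚ × ℚ) → (Fin n → ℝ) → Prop :=
    Sum.elim (fun q y => A (y, (q : ℝ))) (fun i y => ∃ t, GG A i (y, t))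
  have hB : ∀ i, Dp L (B i) := by
    rintro (q | i)
    · exact hA.comp (f := fun y : Fin n → ℝ => (y, (q : ℝ))) (by fun_prop)
    · exact Dp.ex (hA.GG i)
  have hcov : ∀ y ∈ U, ∃ i, B i y := by
    intro y hy
    by_cases h : ∃ q : ℚ, A (y, (q : ℝ))
    · obtain ⟨q, hq⟩ := h
      exact ⟨Sum.inl q, hq⟩
    · push Not at h
      obtain ⟨t, ht⟩ := hc y hy
      obtain ⟨i, hi⟩ := dec hA y (fun p q hpq => by
        obtain ⟨s, h1, h2⟩ := exists_rat_btwn hpq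
        exact ⟨s, h1, h2, h s⟩) t ht
      exact ⟨Sum.inr i, t, hi⟩
  obtain ⟨i, hi⟩ := (good_pi L n).key hB hU hne hcov
  refine ⟨_, Set.inter_subset_left, hU.inter isOpen_interior, hi, ?_⟩
  rcases i with q | i
  · exact ⟨fun _ => q, by fun_prop, fun y hy => (int_sub hy.2 : B (Sum.inl q) y)⟩
  · obtain ⟨v, hv, hvG⟩ := exists_fun (hA.GG i) GG.func
    refine ⟨v, hv, fun y hy => ?_⟩
    obtain ⟨t, ht⟩ : B (Sum.inr i) y := int_sub hy.2
    rw [hvG y t ht]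
    exact ht.sub

theorem section_pi {n : ℕ} (m : ℕ) : ∀ {A : (Fin n → ℝ) × (Fin m → ℝ) → Prop}, Dp L A →
    ∀ {U : Set (Fin n → ℝ)}, IsOpen U → U.Nonempty → (∀ y ∈ U, ∃ x, A (y, x)) →
    ∃ V ⊆ U, IsOpen V ∧ V.Nonempty ∧ ∃ g : Fin m → (Fin n → ℝ) → ℝ, (∀ j, DM L (g j)) ∧
      ∀ y ∈ V, A (y, fun j => g j y) := by
  induction m with
  | zero =>
    intro A hA U hU hne hc
    refine ⟨U, subset_rfl, hU, hne, fun j => j.elim0, fun j => j.elim0, fun y hy => ?_⟩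
    obtain ⟨x, hx⟩ := hc y hy
    convert hx using 2
  | succ m ih =>
    intro A hA U hU hne hc
    have hcons : ∀ {X : Type} [Coo X] {f : X → ℝ} {g : X → Fin m → ℝ}, DM L f → DM L g →
        DM L (fun z => (Fin.cons (f z) (g z) : Fin (m + 1) → ℝ)) := by
      intro X _ f g hf hg
      refine DM.pi fun i => ?_
      refine Fin.cases ?_ (fun j => ?_) i
      · simpa using hf
      · simpa using (DM.ev j).comp' hg
    obtain ⟨V, hVU, hV, hVn, g, hg, hgA⟩ := ih
      (A := fun p => ∃ t : ℝ, A (p.1, (Fin.cons t p.2 : Fin (m + 1) → ℝ)))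
      (Dp.ex (hA.comp (f := fun q : ((Fin n → ℝ) × (Fin m → ℝ)) × ℝ =>
        (q.1.1, (Fin.cons q.2 q.1.2 : Fin (m + 1) → ℝ)))
        (DM.pair (by fun_prop) (hcons (by fun_prop) (by fun_prop))))) hU hne
      (fun y hy => by
        obtain ⟨x, hx⟩ := hc y hy
        refine ⟨Fin.tail x, x 0, ?_⟩
        simpa using hx)
    have hgv : DM L (fun y : Fin n → ℝ => fun j => g j y) := DM.pi hg
    obtain ⟨W, hWV, hW, hWn, g0, hg0, hg0A⟩ := section_one
      (A := fun p => A (p.1, (Fin.cons p.2 (fun j => g j p.1) : Fin (m + 1) → ℝ)))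
      (hA.comp (f := fun p : (Fin n → ℝ) × ℝ =>
        (p.1, (Fin.cons p.2 (fun j => g j p.1) : Fin (m + 1) → ℝ)))
        (DM.pair (by fun_prop) (hcons (by fun_prop)
          (DM.comp' (f := fun p : (Fin n → ℝ) × ℝ => p.1) hgv (by fun_prop))))) hV hVn hgA
    refine ⟨W, hWV.trans hVU, hW, hWn, Fin.cons g0 g, ?_, fun y hy => ?_⟩
    · intro j
      refine Fin.cases ?_ (fun j => ?_) j
      · simpa using hg0
      · simpa using hg j
    · have := hg0A y hy
      convert this using 2
      funext j
      refine Fin.cases ?_ (fun j => ?_) j <;> simp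

end Several

section Final

variable {L} [hL : Fact (DMinimal L)]

def QQ {m n : ℕ} (M : Set (Fin m → ℝ)) (f : (Fin m → ℝ) → (Fin n → ℝ)) (x : Fin m → ℝ)
    (y : Fin n → ℝ) : Prop :=
  ∀ w : Fin n → ℝ, ∃ v : Fin m → ℝ, ∀ ε : ℝ, 0 < ε → ∃ δ : ℝ, 0 < δ ∧ ∀ t : ℝ, |t| < δ →
    ∃ z : Fin m → ℝ, ∃ z1 : Fin n → ℝ, (z ∈ M ∧ z1 = f z) ∧
      (∀ i, |z i - x i - t * v i| ≤ ε * |t|) ∧ ∀ j, |z1 j - y j - t * w j| ≤ ε * |t|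

theorem Dp.QQ {m n : ℕ} {M : Set (Fin m → ℝ)} {f : (Fin m → ℝ) → (Fin n → ℝ)}
    (hf : Dp L (fun p : (Fin m → ℝ) × (Fin n → ℝ) => p.1 ∈ M ∧ p.2 = f p.1)) :
    Dp L (fun p : (Fin m → ℝ) × (Fin n → ℝ) => QQ M f p.1 p.2) := by
  unfold DMinPaper.QQ
  refine Dp.all (Dp.ex (Dp.all (Dp.imp (Dp.lt ?_ ?_) (Dp.ex (Dp.and (Dp.lt ?_ ?_)
    (Dp.all (Dp.imp (Dp.lt ?_ ?_) (Dp.ex (Dp.ex (Dp.and ?_ (Dp.and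
      (Dp.allFin fun i => Dp.le ?_ ?_) (Dp.allFin fun j => Dp.le ?_ ?_))))))))))))
  iterate 6 fun_prop
  · exact hf.comp (DM.pair (DM.snd (DM.fst DM.id')) (DM.snd DM.id'))
  all_goals fun_prop

theorem hasDerivAt_bound {k : ℕ} {γ : ℝ → Fin k → ℝ} {v : Fin k → ℝ} :
    HasDerivAt γ v 0 ↔ ∀ ε : ℝ, 0 < ε → ∀ᶠ t in 𝓝 (0 : ℝ),
      ∀ i, |γ t i - γ 0 i - t * v i| ≤ ε * |t| := by
  rw [hasDerivAt_iff_isLittleO, Asymptotics.isLittleO_iff]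
  refine forall_congr' fun ε => forall_congr' fun hε => eventually_congr ?_
  refine Eventually.of_forall fun t => ?_
  rw [pi_norm_le_iff_of_nonneg (by positivity)]
  simp

theorem submersion_iff {m n : ℕ} {M : Set (Fin m → ℝ)} {f : (Fin m → ℝ) → (Fin n → ℝ)}
    {x : Fin m → ℝ} (hx : x ∈ M) :
    SubmersionAtOn f M Set.univ x ↔ QQ M f x (f x) := by
  constructor
  · intro h w
    obtain ⟨γ, v, h0, hM, hd, hd'⟩ := h w ⟨fun t => f x + t • w, by simp, by simp, by
      simpa using ((hasDerivAt_id (0 : ℝ)).smul_const w).const_add (f x)⟩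
    refine ⟨v, fun ε hε => ?_⟩
    have h1 := hasDerivAt_bound.1 hd ε hε
    have h2 := hasDerivAt_bound.1 hd' ε hε
    obtain ⟨δ, hδ, hb⟩ := Metric.eventually_nhds_iff.1 (hM.and (h1.and h2))
    refine ⟨δ, hδ, fun t ht => ?_⟩
    obtain ⟨a, b, c⟩ := hb (y := t) (by simpa [Real.dist_eq] using ht)
    rw [h0] at b c
    exact ⟨γ t, f (γ t), ⟨a, rfl⟩, b, c⟩
  · intro h w _
    obtain ⟨v, hv⟩ := h w
    let E : ℝ → (Fin m → ℝ) → ℝ := fun t z => ‖z - x - t • v‖ + ‖f z - f x - t • w‖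
    have hE0 : ∀ t z, 0 ≤ E t z := fun t z => by positivity
    have hbdd : ∀ t, BddBelow (E t '' M) := fun t => ⟨0, by
      rintro _ ⟨z, _, rfl⟩; exact hE0 t z⟩
    have hch : ∀ t : ℝ, ∃ z ∈ M, (t = 0 → z = x) ∧ E t z ≤ sInf (E t '' M) + t ^ 2 := by
      intro t
      by_cases ht : t = 0
      · refine ⟨x, hx, fun _ => rfl, ?_⟩
        have : E t x = 0 := by simp [E, ht]
        rw [this]
        have : 0 ≤ sInf (E t '' M) := Real.sInf_nonneg (by
          rintro _ ⟨z, _, rfl⟩; exact hE0 t z)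
        positivity
      · have h2 : 0 < t ^ 2 := by positivity
        obtain ⟨_, ⟨z, hz, rfl⟩, hlt⟩ := exists_lt_of_csInf_lt (⟨_, x, hx, rfl⟩ : (E t '' M).Nonempty)
          (lt_add_of_pos_right (sInf (E t '' M)) h2)
        exact ⟨z, hz, fun h => (ht h).elim, hlt.le⟩
    choose γ hγM hγ0 hγE using hch
    have h0 : γ 0 = x := hγ0 0 rfl
    have key : ∀ ε : ℝ, 0 < ε → ∀ᶠ t in 𝓝 (0 : ℝ), E t (γ t) ≤ ε * |t| := by
      intro ε hε
      obtain ⟨δ, hδ, hb⟩ := hv (ε / 3) (by positivity)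
      refine Metric.eventually_nhds_iff.2 ⟨min δ (ε / 3), by positivity, fun t ht => ?_⟩
      rw [Real.dist_eq, sub_zero] at ht
      obtain ⟨z, z1, ⟨hz, rfl⟩, ha, hc⟩ := hb t (ht.trans_le (min_le_left _ _))
      have hp : 0 ≤ ε / 3 * |t| := by positivity
      have e1 : ‖z - x - t • v‖ ≤ ε / 3 * |t| := (pi_norm_le_iff_of_nonneg hp).2 ha
      have e2 : ‖f z - f x - t • w‖ ≤ ε / 3 * |t| := (pi_norm_le_iff_of_nonneg hp).2 hc
      have e3 : sInf (E t '' M) ≤ E t z := csInf_le (hbdd t) ⟨z, hz, rfl⟩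
      have e4 : t ^ 2 ≤ ε / 3 * |t| := by
        rw [← sq_abs, sq]
        exact mul_le_mul_of_nonneg_right (ht.le.trans (min_le_right _ _)) (abs_nonneg _)
      have e5 := hγE t
      have e6 : E t z = ‖z - x - t • v‖ + ‖f z - f x - t • w‖ := rfl
      linarith
    refine ⟨γ, v, h0, Eventually.of_forall hγM, hasDerivAt_bound.2 fun ε hε => ?_,
      hasDerivAt_bound.2 fun ε hε => ?_⟩
    · filter_upwards [key ε hε] with t ht i
      rw [h0]
      have e1 := norm_le_pi_norm (γ t - x - t • v) i
      have e2 : 0 ≤ ‖f (γ t) - f x - t • w‖ := norm_nonneg _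
      have e3 : E t (γ t) = ‖γ t - x - t • v‖ + ‖f (γ t) - f x - t • w‖ := rfl
      have e4 : ‖(γ t - x - t • v) i‖ = |γ t i - x i - t * v i| := rfl
      linarith
    · filter_upwards [key ε hε] with t ht i
      rw [h0]
      have e1 := norm_le_pi_norm (f (γ t) - f x - t • w) i
      have e2 : 0 ≤ ‖γ t - x - t • v‖ := norm_nonneg _
      have e3 : E t (γ t) = ‖γ t - x - t • v‖ + ‖f (γ t) - f x - t • w‖ := rfl
      have e4 : ‖(f (γ t) - f x - t • w) i‖ = |f (γ t) i - f x i - t * w i| := rfl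
      linarith

theorem dim_lt {n : ℕ} {S : Set (Fin n → ℝ)} (h : ¬ (interior S).Nonempty) :
    dimDef S < (n : WithBot ℕ) := by
  unfold dimDef
  split_ifs with hS
  · refine WithBot.coe_lt_coe.2 ?_
    have hle : ∀ d, hasDimGE S d → d ≤ n := by
      rintro d ⟨ι, hι, _⟩
      simpa using Fintype.card_le_of_injective ι hι.injective
    have h0 : hasDimGE S 0 := by
      refine ⟨fun i => i.elim0, fun i => i.elim0, ?_⟩
      have : ((fun x : Fin n → ℝ => fun i : Fin 0 => x (i.elim0)) '' S) = Set.univ := by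
        obtain ⟨x, hx⟩ := hS
        refine Set.eq_univ_of_forall fun y => ⟨x, hx, Subsingleton.elim _ _⟩
      rw [this, interior_univ]
      exact Set.univ_nonempty
    have hmem : hasDimGE S (sSup {d | hasDimGE S d}) :=
      Nat.sSup_mem (s := {d | hasDimGE S d}) ⟨0, h0⟩ ⟨n, hle⟩
    refine lt_of_le_of_ne (hle _ hmem) fun he => h ?_
    have he : sSup {d | hasDimGE S d} = n := he
    rw [he] at hmem
    obtain ⟨ι, hι, hi⟩ := hmem
    have hid : ι = id := by
      funext i
      have hs := Finite.injective_iff_surjective.1 hι.injective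
      have : (hι.orderIsoOfSurjective ι hs) = OrderIso.refl (Fin n) := Subsingleton.elim _ _
      simpa using congrArg (fun e : Fin n ≃o Fin n => e i) this
    subst hid
    simpa using hi
  · exact WithBot.bot_lt_coe _

end Final

/-- definable Sard's theorem. -/
theorem stmt1 (L : FirstOrder.Language) [L.Structure ℝ] (hL : DMinimal L)
    (m n d : ℕ) (M : Set (Fin m → ℝ)) (hM : IsDpSubmanifold L 1 d M)
    (f : (Fin m → ℝ) → (Fin n → ℝ)) (hfdef : IsDefMapOn L M f) (hfC : CpOn 1 f M) :
    IsDef L {y : Fin n → ℝ | ∃ x ∈ M, f x = y ∧ ¬ SubmersionAtOn f M Set.univ x} ∧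
    dimDef {y : Fin n → ℝ | ∃ x ∈ M, f x = y ∧ ¬ SubmersionAtOn f M Set.univ x} <
      (n : WithBot ℕ) := by
  haveI : Fact (DMinimal L) := ⟨hL⟩
  have hf : Dp L (fun p : (Fin m → ℝ) × (Fin n → ℝ) => p.1 ∈ M ∧ p.2 = f p.1) := hfdef
  have hA : Dp L (fun p : (Fin n → ℝ) × (Fin m → ℝ) =>
      p.2 ∈ M ∧ f p.2 = p.1 ∧ ¬ SubmersionAtOn f M Set.univ p.2) := by
    have h1 : Dp L (fun p : (Fin n → ℝ) × (Fin m → ℝ) => p.2 ∈ M ∧ p.1 = f p.2) :=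
      hf.comp (f := fun p : (Fin n → ℝ) × (Fin m → ℝ) => (p.2, p.1)) (by fun_prop)
    have h2 : Dp L (fun p : (Fin n → ℝ) × (Fin m → ℝ) => QQ M f p.2 p.1) :=
      (Dp.QQ hf).comp (f := fun p : (Fin n → ℝ) × (Fin m → ℝ) => (p.2, p.1)) (by fun_prop)
    refine (h1.and h2.not).congr fun p => ?_
    constructor
    · rintro ⟨a, b, c⟩
      rw [submersion_iff a, b] at c
      exact ⟨⟨a, b.symm⟩, c⟩
    · rintro ⟨⟨a, b⟩, c⟩
      refine ⟨a, b.symm, ?_⟩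
      rw [submersion_iff a, ← b]
      exact c
  constructor
  · have := Dp.ex (P := fun (y : Fin n → ℝ) (x : Fin m → ℝ) =>
      x ∈ M ∧ f x = y ∧ ¬ SubmersionAtOn f M Set.univ x) hA
    exact this
  · apply dim_lt
    intro hne
    obtain ⟨V, hVU, hV, hVn, g, hg, hgA⟩ := section_pi m hA isOpen_interior hne
      (fun y hy => by
        obtain ⟨x, hx⟩ := interior_subset hy
        exact ⟨x, hx⟩)
    obtain ⟨y, hy, hd⟩ := exists_diff g hg hV hVn
    refine (hgA y hy).2.2 fun w _ => ?_
    have hline : HasDerivAt (fun t : ℝ => y + t • w) w 0 := by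
      simpa using ((hasDerivAt_id (0 : ℝ)).smul_const w).const_add y
    have hy0 : y + (0 : ℝ) • w = y := by simp
    have hev : ∀ᶠ t : ℝ in 𝓝 0, y + t • w ∈ V :=
      hline.continuousAt.eventually_mem (by simpa using hV.mem_nhds hy)
    refine ⟨fun t => (fun y => fun j => g j y) (y + t • w),
      fderiv ℝ (fun y => fun j => g j y) y w, by simp,
      hev.mono fun t ht => (hgA _ ht).1, ?_, ?_⟩
    · exact HasFDerivAt.comp_hasDerivAt (0 : ℝ) (l := fun y => fun j => g j y)
        (by rw [hy0]; exact hd.hasFDerivAt) hline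
    · exact hline.congr_of_eventuallyEq (hev.mono fun t ht => (hgA _ ht).2.1)

end DMinPaper
end
end

section
/- Suppose the structure on ℝ is d-minimal. Let π be the projection of ℝⁿ onto the first d coordinates, U ⊆ ℝⁿ a D² multi-valued graph with respect to π, and f : ℝ^k × U → ℝ a D² function; for t ∈ ℝ^k set f_t(x) := f(t,x). Assume the definable map Φ : ℝ^k × U → ℝ^d × ℝ^d given by Φ(t,x) = (df_t(x), π(x)) is a submersion, where df_t = (∂f_t/∂x₁, …, ∂f_t/∂x_d) is computed via local sections of the multi-valued graph. Then the set Z = {t ∈ ℝ^k : f_t has a degenerate critical point} has dimension strictly smaller than k. -/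
open FirstOrder Set Filter Topology
open scoped Classical

noncomputable section

namespace DMinPaper

variable (L : FirstOrder.Language) [L.Structure ℝ]

variable {E F : Type} [NormedAddCommGroup E] [NormedSpace ℝ E]
  [NormedAddCommGroup F] [NormedSpace ℝ F]

theorem aux_exists_equiv {k d : ℕ} (A : ((Fin k → ℝ) × (Fin d → ℝ)) →L[ℝ] (Fin d → ℝ))
    (hA : Function.Surjective A) :
    ∃ P : ((Fin k → ℝ) × (Fin d → ℝ)) →L[ℝ] (Fin k → ℝ), Function.Bijective (A.prod P) := by
  let K : Submodule ℝ ((Fin k → ℝ) × (Fin d → ℝ)) := LinearMap.ker A.toLinearMap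
  obtain ⟨p, hp⟩ := K.subtype.exists_leftInverse_of_injective K.ker_subtype
  have hfr : Module.finrank ℝ K = Module.finrank ℝ (Fin k → ℝ) := by
    have h1 := LinearMap.finrank_range_add_finrank_ker A.toLinearMap
    rw [LinearMap.range_eq_top.2 hA, finrank_top] at h1
    simp only [Module.finrank_prod, Module.finrank_fin_fun] at h1 ⊢
    change d + Module.finrank ℝ K = k + d at h1
    omega
  let l : K ≃ₗ[ℝ] (Fin k → ℝ) := LinearEquiv.ofFinrankEq _ _ hfr
  refine ⟨LinearMap.toContinuousLinearMap (l.toLinearMap.comp p), ?_⟩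
  have hinj : Function.Injective
      (A.prod (LinearMap.toContinuousLinearMap (l.toLinearMap.comp p))).toLinearMap := by
    rw [injective_iff_map_eq_zero]
    intro q hq
    have hq1 : A q = 0 := congrArg Prod.fst hq
    have hq2 : l (p q) = 0 := congrArg Prod.snd hq
    have hq3 : p q = 0 := by simpa using hq2
    have hq4 : p q = ⟨q, hq1⟩ := DFunLike.congr_fun hp (⟨q, hq1⟩ : K)
    rw [hq3] at hq4
    exact (congrArg Subtype.val hq4).symm
  refine ⟨hinj, (LinearMap.injective_iff_surjective_of_finrank_eq_finrank ?_).1 hinj⟩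
  simp [add_comm]

theorem aux_sard {k d : ℕ} (G : (Fin k → ℝ) × (Fin d → ℝ) → (Fin d → ℝ))
    (a : (Fin k → ℝ) × (Fin d → ℝ)) (hG : ContDiffAt ℝ 1 G a)
    (hs : Function.Surjective (fderiv ℝ G a)) :
    ∃ N ∈ 𝓝 a, MeasureTheory.volume (Prod.fst '' {q | q ∈ N ∧ G q = 0 ∧
      ∃ v : Fin d → ℝ, v ≠ 0 ∧ fderiv ℝ G q (0, v) = 0}) = 0 := by
  obtain ⟨P, hP⟩ := aux_exists_equiv _ hs
  set e : ((Fin k → ℝ) × (Fin d → ℝ)) ≃L[ℝ] ((Fin d → ℝ) × (Fin k → ℝ)) :=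
    ContinuousLinearEquiv.ofBijective ((fderiv ℝ G a).prod P)
      (LinearMap.ker_eq_bot.2 hP.1) (LinearMap.range_eq_top.2 hP.2) with he
  have hee : (e : ((Fin k → ℝ) × (Fin d → ℝ)) →L[ℝ] ((Fin d → ℝ) × (Fin k → ℝ)))
      = (fderiv ℝ G a).prod P := by
    rw [he]; exact ContinuousLinearEquiv.coe_ofBijective _ _ _
  have hΦ : ContDiffAt ℝ 1 (fun q => (G q, P q)) a := hG.prodMk P.contDiff.contDiffAt
  have hΦ' : HasFDerivAt (fun q => (G q, P q))
      (e : ((Fin k → ℝ) × (Fin d → ℝ)) →L[ℝ] ((Fin d → ℝ) × (Fin k → ℝ))) a := by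
    rw [hee]
    exact (hG.differentiableAt one_ne_zero).hasFDerivAt.prodMk P.hasFDerivAt
  set Ψ := hΦ.localInverse hΦ' one_ne_zero with hΨ
  have hinv : ∀ᶠ q in 𝓝 a, Ψ (G q, P q) = q :=
    (hΦ.hasStrictFDerivAt' hΦ' one_ne_zero).eventually_left_inverse
  have hΨc : ContDiffAt ℝ 1 Ψ (G a, P a) := hΦ.to_localInverse hΦ' one_ne_zero
  have hΨd : ∀ᶠ y in 𝓝 (G a, P a), DifferentiableAt ℝ Ψ y := by
    filter_upwards [hΨc.eventually (by simp)] with y hy using hy.differentiableAt one_ne_zero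
  have hΨd' : ∀ᶠ q in 𝓝 a, DifferentiableAt ℝ Ψ (G q, P q) :=
    hΦ.continuousAt.eventually hΨd
  have hGd : ∀ᶠ q in 𝓝 a, DifferentiableAt ℝ G q := by
    filter_upwards [hG.eventually (by simp)] with y hy using hy.differentiableAt one_ne_zero
  refine ⟨_, (hinv.eventually_nhds.and (hΨd'.and hGd)), ?_⟩
  set C := {q | q ∈ {q | (∀ᶠ q' in 𝓝 q, Ψ (G q', P q') = q') ∧
    DifferentiableAt ℝ Ψ (G q, P q) ∧ DifferentiableAt ℝ G q} ∧ G q = 0 ∧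
      ∃ v : Fin d → ℝ, v ≠ 0 ∧ fderiv ℝ G q (0, v) = 0} with hC
  let h : (Fin k → ℝ) → (Fin k → ℝ) := fun s => (Ψ (0, s)).1
  have himg : Prod.fst '' C ⊆ h '' (P '' C) := by
    rintro _ ⟨q, hq, rfl⟩
    refine ⟨_, ⟨q, hq, rfl⟩, ?_⟩
    have h1 := hq.1.1.self_of_nhds
    rw [hq.2.1] at h1
    simp only [h, h1]
  refine MeasureTheory.measure_mono_null himg ?_
  let h' : (Fin k → ℝ) → ((Fin k → ℝ) →L[ℝ] (Fin k → ℝ)) := fun s =>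
    (ContinuousLinearMap.fst ℝ (Fin k → ℝ) (Fin d → ℝ)).comp
      ((fderiv ℝ Ψ (0, s)).comp (ContinuousLinearMap.inr ℝ (Fin d → ℝ) (Fin k → ℝ)))
  refine MeasureTheory.addHaar_image_eq_zero_of_det_fderivWithin_eq_zero (f := h) (f' := h')
    MeasureTheory.volume ?_ ?_
  · rintro _ ⟨q, hq, rfl⟩
    have h1 : DifferentiableAt ℝ Ψ (0, P q) := by
      have := hq.1.2.1
      rwa [hq.2.1] at this
    have h2 : HasFDerivAt (fun s : Fin k → ℝ => ((0 : Fin d → ℝ), s))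
        (ContinuousLinearMap.inr ℝ (Fin d → ℝ) (Fin k → ℝ)) (P q) :=
      (ContinuousLinearMap.inr ℝ (Fin d → ℝ) (Fin k → ℝ)).hasFDerivAt
    exact ((ContinuousLinearMap.fst ℝ (Fin k → ℝ) (Fin d → ℝ)).hasFDerivAt.comp (P q)
      (h1.hasFDerivAt.comp (P q) h2)).hasFDerivWithinAt
  · rintro _ ⟨q, hq, rfl⟩
    obtain ⟨⟨hq1, hq2, hq3⟩, hq4, v, hv, hv2⟩ := hq
    have hcomp : HasFDerivAt (fun q' => Ψ (G q', P q'))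
        ((fderiv ℝ Ψ (G q, P q)).comp ((fderiv ℝ G q).prod P)) q :=
      HasFDerivAt.comp (f := fun q' => (G q', P q')) q hq2.hasFDerivAt
        (hq3.hasFDerivAt.prodMk P.hasFDerivAt)
    have hid : HasFDerivAt (fun q' => Ψ (G q', P q')) (ContinuousLinearMap.id ℝ _) q :=
      (hasFDerivAt_id q).congr_of_eventuallyEq hq1
    have heq := DFunLike.congr_fun (hcomp.unique hid) (0, v)
    simp only [ContinuousLinearMap.comp_apply, ContinuousLinearMap.prod_apply, hv2, hq4,
      ContinuousLinearMap.id_apply] at heq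
    rw [ContinuousLinearMap.det, LinearMap.det_eq_zero_iff_ker_ne_bot]
    intro hk
    have hmem : P (0, v) ∈ LinearMap.ker ((h' (P q) : (Fin k → ℝ) →L[ℝ] (Fin k → ℝ)) :
        (Fin k → ℝ) →ₗ[ℝ] (Fin k → ℝ)) := by
      simp [h', heq]
    rw [hk, Submodule.mem_bot] at hmem
    rw [hmem] at heq
    have : ((0 : Fin d → ℝ), (0 : Fin k → ℝ)) = 0 := rfl
    rw [this, map_zero] at heq
    exact hv (congrArg Prod.snd heq).symm

theorem aux_deriv {k d : ℕ} (g : (Fin k → ℝ) × (Fin d → ℝ) → ℝ)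
    (a : (Fin k → ℝ) × (Fin d → ℝ)) (hg : ContDiffAt ℝ 2 g a) :
    ContDiffAt ℝ 1 (fun q : (Fin k → ℝ) × (Fin d → ℝ) => gradVec (fun z => g (q.1, z)) q.2) a ∧
    ∀ v j, fderiv ℝ (fun q : (Fin k → ℝ) × (Fin d → ℝ) => gradVec (fun z => g (q.1, z)) q.2) a
      (0, v) j = (Matrix.vecMul v (hessMat (fun z => g (a.1, z)) a.2)) j := by
  have hev : (fun q : (Fin k → ℝ) × (Fin d → ℝ) => gradVec (fun z => g (q.1, z)) q.2) =ᶠ[𝓝 a]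
      fun q i => fderiv ℝ g q (0, Pi.single i 1) := by
    filter_upwards [hg.eventually (by simp)] with q hq
    funext i
    have h1 : HasFDerivAt (fun z => g (q.1, z))
        ((fderiv ℝ g q).comp (ContinuousLinearMap.inr ℝ (Fin k → ℝ) (Fin d → ℝ))) q.2 :=
      HasFDerivAt.comp (f := fun z => (q.1, z)) q.2
        (hq.differentiableAt two_ne_zero).hasFDerivAt (hasFDerivAt_prodMk_right q.1 q.2)
    simp [gradVec, h1.fderiv]
  have hc : ContDiffAt ℝ 1 (fun (q : (Fin k → ℝ) × (Fin d → ℝ)) (i : Fin d) =>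
      fderiv ℝ g q (0, Pi.single i 1)) a := by
    rw [contDiffAt_pi]
    intro i
    exact (hg.fderiv_right (m := 1) (by norm_num)).clm_apply contDiffAt_const
  have hc' := hc.congr_of_eventuallyEq hev
  refine ⟨hc', fun v j => ?_⟩
  have hd := (hc'.differentiableAt one_ne_zero).hasFDerivAt
  set G := (fun q : (Fin k → ℝ) × (Fin d → ℝ) => gradVec (fun z => g (q.1, z)) q.2) with hG
  have hdj : HasFDerivAt (fun w => fderiv ℝ (fun z => g (a.1, z)) w (Pi.single j 1))
      ((ContinuousLinearMap.proj (R := ℝ) (φ := fun _ : Fin d => ℝ) j).comp ((fderiv ℝ G a).comp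
        (ContinuousLinearMap.inr ℝ (Fin k → ℝ) (Fin d → ℝ)))) a.2 :=
    (ContinuousLinearMap.proj (R := ℝ) (φ := fun _ : Fin d => ℝ) j).hasFDerivAt.comp a.2
      (HasFDerivAt.comp (g := G) (f := fun z => (a.1, z)) a.2 hd
        (hasFDerivAt_prodMk_right a.1 a.2))
  have hv : v = ∑ i, v i • (Pi.single i 1 : Fin d → ℝ) := by
    rw [← pi_eq_sum_univ' v]
  have key : fderiv ℝ G a (0, v) j =
      fderiv ℝ (fun w => fderiv ℝ (fun z => g (a.1, z)) w (Pi.single j 1)) a.2 v := by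
    rw [hdj.fderiv]; simp
  rw [key]
  conv_lhs => rw [hv]
  rw [map_sum]
  simp [Matrix.vecMul, dotProduct, hessMat]

theorem aux_box_open {n d : ℕ} (hdn : d ≤ n) (B : Set (Fin n → ℝ)) (hB : IsOpenBox B) :
    IsOpen B ∧ IsOpen (projc (Fin.castLE hdn) '' B) := by
  obtain ⟨a, b, hab, rfl⟩ := hB
  refine ⟨isOpen_set_pi finite_univ fun i _ => isOpen_Ioo, ?_⟩
  have : projc (Fin.castLE hdn) '' (univ.pi fun i => Ioo (a i) (b i)) =
      univ.pi fun i : Fin d => Ioo (a (Fin.castLE hdn i)) (b (Fin.castLE hdn i)) := by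
    ext z
    constructor
    · rintro ⟨x, hx, rfl⟩ i _
      exact hx _ trivial
    · intro hz
      refine ⟨fun i => if h : (i : ℕ) < d then z ⟨i, h⟩ else (a i + b i) / 2, ?_, ?_⟩
      · intro i _
        by_cases h : (i : ℕ) < d
        · simpa [h] using hz ⟨i, h⟩ trivial
        · have := hab i
          simp only [h, dite_false]
          constructor <;> linarith
      · funext i
        simp [projc]
  rw [this]
  exact isOpen_set_pi finite_univ fun i _ => isOpen_Ioo

theorem aux_section_eq {n d : ℕ} (hdn : d ≤ n) (U B B₁ : Set (Fin n → ℝ))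
    (τ τ₁ : (Fin d → ℝ) → (Fin n → ℝ)) (x : Fin n → ℝ) (hx : x ∈ U)
    (hB : IsOpenBox B) (hxB : x ∈ B) (hB₁ : IsOpenBox B₁) (hxB₁ : x ∈ B₁)
    (hτ : ContDiffOn ℝ 2 τ (projc (Fin.castLE hdn) '' B))
    (h1 : U ∩ B = τ '' (projc (Fin.castLE hdn) '' B))
    (h2 : ∀ z ∈ projc (Fin.castLE hdn) '' B, projc (Fin.castLE hdn) (τ z) = z)
    (h1' : U ∩ B₁ = τ₁ '' (projc (Fin.castLE hdn) '' B₁))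
    (h2' : ∀ z ∈ projc (Fin.castLE hdn) '' B₁, projc (Fin.castLE hdn) (τ₁ z) = z) :
    τ (projc (Fin.castLE hdn) x) = x ∧ τ =ᶠ[𝓝 (projc (Fin.castLE hdn) x)] τ₁ := by
  have hO := aux_box_open hdn B hB
  have hO₁ := aux_box_open hdn B₁ hB₁
  have hxx : τ (projc (Fin.castLE hdn) x) = x := by
    obtain ⟨z, hz, rfl⟩ : x ∈ τ '' (projc (Fin.castLE hdn) '' B) := h1 ▸ ⟨hx, hxB⟩
    rw [h2 z hz]
  refine ⟨hxx, ?_⟩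
  have hzmem : projc (Fin.castLE hdn) '' B ∈ 𝓝 (projc (Fin.castLE hdn) x) :=
    hO.2.mem_nhds ⟨x, hxB, rfl⟩
  have hcont : ContinuousAt τ (projc (Fin.castLE hdn) x) :=
    hτ.continuousOn.continuousAt hzmem
  have hB1 : B₁ ∈ 𝓝 (τ (projc (Fin.castLE hdn) x)) := by
    rw [hxx]; exact hO₁.1.mem_nhds hxB₁
  filter_upwards [hzmem, hcont hB1] with z hz hz1
  have hm : τ z ∈ U ∩ B₁ := ⟨(h1 ▸ mem_image_of_mem τ hz : τ z ∈ U ∩ B).1, hz1⟩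
  rw [h1'] at hm
  obtain ⟨w, hw, hwz⟩ := hm
  have : w = z := by rw [← h2' w hw, hwz, h2 z hz]
  rw [← hwz, this]

theorem aux_congr {d : ℕ} (g g₁ : (Fin d → ℝ) → ℝ) (z : Fin d → ℝ) (h : g =ᶠ[𝓝 z] g₁) :
    gradVec g z = gradVec g₁ z ∧ hessMat g z = hessMat g₁ z := by
  constructor
  · funext i
    simp only [gradVec, h.fderiv_eq]
  · ext i j
    have : (fun w => fderiv ℝ g w (Pi.single j 1)) =ᶠ[𝓝 z]
        fun w => fderiv ℝ g₁ w (Pi.single j 1) := by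
      filter_upwards [h.fderiv (𝕜 := ℝ)] with w hw
      rw [hw]
    simp only [hessMat, Matrix.of_apply, this.fderiv_eq]

theorem aux_dim {k : ℕ} (Z : Set (Fin k → ℝ)) (hZ : MeasureTheory.volume Z = 0) :
    dimDef Z < (k : WithBot ℕ) := by
  have hint : interior Z = ∅ := MeasureTheory.Measure.interior_eq_empty_of_null hZ
  have hnot : ¬ hasDimGE Z k := by
    rintro ⟨ι, hι, hne⟩
    have : ι = id := by
      have h1 : Set.range ι = Set.range (id : Fin k → Fin k) := by
        rw [(Finite.injective_iff_surjective.1 hι.injective).range_eq, Set.range_id]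
      exact (StrictMono.range_inj hι strictMono_id).1 h1
    subst this
    simp [hint] at hne
  unfold dimDef
  split_ifs with h
  · rw [Nat.cast_lt] 
    have hle : ∀ m ∈ {d : ℕ | hasDimGE Z d}, m ≤ k := by
      rintro m ⟨ι, hι, -⟩
      simpa using Fintype.card_le_of_injective ι hι.injective
    have h0 : {d : ℕ | hasDimGE Z d}.Nonempty := by
      refine ⟨0, fun i => i.elim0, fun i => i.elim0, ?_⟩
      obtain ⟨t, ht⟩ := h
      refine ⟨fun i => i.elim0, ?_⟩
      have : (fun x : Fin k → ℝ => fun i : Fin 0 => x (i.elim0)) '' Z = univ := by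
        ext y
        simp only [mem_univ, iff_true]
        exact ⟨t, ht, Subsingleton.elim _ _⟩
      rw [this]; simp
    have hmem := Nat.sSup_mem h0 ⟨k, hle⟩
    refine lt_of_le_of_ne (hle _ hmem) fun heq => hnot ?_
    rw [heq] at hmem
    exact hmem
  · exact WithBot.bot_lt_coe _

/-- generic absence of degenerate critical points in a definable family. -/
theorem stmt3 (L : FirstOrder.Language) [L.Structure ℝ] (hL : DMinimal L)
    (n d k : ℕ) (hdn : d ≤ n)
    (U : Set (Fin n → ℝ)) (hU : IsMultiGraph L 2 (Fin.castLE hdn) U)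
    (f : (Fin k → ℝ) → (Fin n → ℝ) → ℝ)
    (hfdef : IsDefFun2On L (Set.univ ×ˢ U) (fun z => f z.1 z.2))
    (hfC : CpOn 2 (fun z : (Fin k → ℝ) × (Fin n → ℝ) => f z.1 z.2) (Set.univ ×ˢ U))
    (hsub : ∀ (t : Fin k → ℝ), ∀ x ∈ U,
      ∀ (B : Set (Fin n → ℝ)) (τ : (Fin d → ℝ) → (Fin n → ℝ)),
        IsOpenBox B → x ∈ B →
        ContDiffOn ℝ 2 τ (projc (Fin.castLE hdn) '' B) →
        U ∩ B = τ '' (projc (Fin.castLE hdn) '' B) →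
        (∀ z ∈ projc (Fin.castLE hdn) '' B, projc (Fin.castLE hdn) (τ z) = z) →
        Function.Surjective (fun v => fderiv ℝ
          (fun sz : (Fin k → ℝ) × (Fin d → ℝ) =>
            (gradVec (fun z => f sz.1 (τ z)) sz.2, sz.2))
          (t, projc (Fin.castLE hdn) x) v)) :
    dimDef {t : Fin k → ℝ | ∃ x ∈ U,
        ∃ (B : Set (Fin n → ℝ)) (τ : (Fin d → ℝ) → (Fin n → ℝ)),
          IsOpenBox B ∧ x ∈ B ∧
          ContDiffOn ℝ 2 τ (projc (Fin.castLE hdn) '' B) ∧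
          U ∩ B = τ '' (projc (Fin.castLE hdn) '' B) ∧
          (∀ z ∈ projc (Fin.castLE hdn) '' B, projc (Fin.castLE hdn) (τ z) = z) ∧
          gradVec (fun z => f t (τ z)) (projc (Fin.castLE hdn) x) = 0 ∧
          (hessMat (fun z => f t (τ z)) (projc (Fin.castLE hdn) x)).det = 0}
      < (k : WithBot ℕ) := by
  apply aux_dim
  set π := projc (Fin.castLE hdn) with hπ
  let Bd : Set ((Fin k → ℝ) × (Fin n → ℝ)) := {q | q.2 ∈ U ∧
        ∃ (B : Set (Fin n → ℝ)) (τ : (Fin d → ℝ) → (Fin n → ℝ)),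
          IsOpenBox B ∧ q.2 ∈ B ∧
          ContDiffOn ℝ 2 τ (π '' B) ∧
          U ∩ B = τ '' (π '' B) ∧
          (∀ z ∈ π '' B, π (τ z) = z) ∧
          gradVec (fun z => f q.1 (τ z)) (π q.2) = 0 ∧
          (hessMat (fun z => f q.1 (τ z)) (π q.2)).det = 0}
  have hBd : (MeasureTheory.OuterMeasure.comap (Prod.fst : (Fin k → ℝ) × (Fin n → ℝ) → _)
      (MeasureTheory.volume : MeasureTheory.Measure (Fin k → ℝ)).toOuterMeasure) Bd = 0 := by
    apply MeasureTheory.measure_null_of_locally_null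
    rintro ⟨t, x⟩ ⟨hxU, B, τ, hB, hxB, hτ, h1, h2, -, -⟩
    simp only at hxU hxB
    have hO := aux_box_open hdn B hB
    have hπc : Continuous π := by
      rw [hπ]; unfold projc; fun_prop
    let g : (Fin k → ℝ) × (Fin d → ℝ) → ℝ := fun q => f q.1 (τ q.2)
    -- C² regularity
    have hgC : ∀ s : Fin k → ℝ, ∀ y ∈ U, y ∈ B → ContDiffAt ℝ 2 g (s, π y) := by
      intro s y hyU hyB
      have hyy : τ (π y) = y := (aux_section_eq hdn U B B τ τ y hyU hB hyB hB hyB hτ h1 h2 h1 h2).1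
      have hnb : π '' B ∈ 𝓝 (π y) := hO.2.mem_nhds ⟨y, hyB, rfl⟩
      have hτy : ContDiffAt ℝ 2 τ (π y) := hτ.contDiffAt hnb
      obtain ⟨V, G, hV, hyV, hGV, hfG⟩ := hfC (s, y) ⟨trivial, hyU⟩
      have hmap : ContDiffAt ℝ 2 (fun q : (Fin k → ℝ) × (Fin d → ℝ) => (q.1, τ q.2)) (s, π y) :=
        contDiffAt_fst.prodMk (ContDiffAt.comp (g := τ) (s, π y) hτy contDiffAt_snd)
      have hGa : ContDiffAt ℝ 2 G (s, τ (π y)) := by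
        rw [hyy]; exact hGV.contDiffAt (hV.mem_nhds hyV)
      have hcomp : ContDiffAt ℝ 2 (fun q : (Fin k → ℝ) × (Fin d → ℝ) => G (q.1, τ q.2)) (s, π y) :=
        ContDiffAt.comp (g := G) (f := fun q : (Fin k → ℝ) × (Fin d → ℝ) => (q.1, τ q.2))
          (s, π y) hGa hmap
      refine hcomp.congr_of_eventuallyEq ?_
      have hVn : V ∈ 𝓝 (s, τ (π y)) := by rw [hyy]; exact hV.mem_nhds hyV
      have e1 : ∀ᶠ q in 𝓝 (s, π y), (q.1, τ q.2) ∈ V := hmap.continuousAt hVn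
      have e2 : ∀ᶠ q : (Fin k → ℝ) × (Fin d → ℝ) in 𝓝 (s, π y), q.2 ∈ π '' B :=
        continuousAt_snd.eventually hnb
      filter_upwards [e1, e2] with q hq1 hq2
      exact hfG ⟨⟨trivial, (h1 ▸ mem_image_of_mem τ hq2 : τ q.2 ∈ U ∩ B).1⟩, hq1⟩
    have hD := aux_deriv g (t, π x) (hgC t x hxU hxB)
    set G : (Fin k → ℝ) × (Fin d → ℝ) → (Fin d → ℝ) :=
      fun q => gradVec (fun z => g (q.1, z)) q.2 with hGdef
    have hGs : Function.Surjective (fderiv ℝ G (t, π x)) := by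
      intro w
      obtain ⟨v, hv⟩ := hsub t x hxU B τ hB hxB hτ h1 h2 (w, 0)
      refine ⟨v, ?_⟩
      have hh : HasFDerivAt (fun sz : (Fin k → ℝ) × (Fin d → ℝ) =>
            (gradVec (fun z => f sz.1 (τ z)) sz.2, sz.2))
          ((fderiv ℝ G (t, π x)).prod (ContinuousLinearMap.snd ℝ (Fin k → ℝ) (Fin d → ℝ)))
          (t, π x) :=
        (hD.1.differentiableAt one_ne_zero).hasFDerivAt.prodMk hasFDerivAt_snd
      simp only [hh.fderiv] at hv
      exact congrArg Prod.fst hv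
    obtain ⟨N, hN, hN0⟩ := aux_sard G (t, π x) hD.1 hGs
    have hcm : Continuous (fun q : (Fin k → ℝ) × (Fin n → ℝ) => (q.1, π q.2)) := by fun_prop
    have hN' : ∀ᶠ q : (Fin k → ℝ) × (Fin n → ℝ) in 𝓝 (t, x), (q.1, π q.2) ∈ N :=
      hcm.continuousAt.eventually hN
    have hBn : ∀ᶠ q : (Fin k → ℝ) × (Fin n → ℝ) in 𝓝 (t, x), q.2 ∈ B :=
      continuousAt_snd.eventually (hO.1.mem_nhds hxB)
    refine ⟨_, inter_mem_nhdsWithin Bd (hN'.and hBn), ?_⟩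
    rw [MeasureTheory.OuterMeasure.comap_apply]
    refine MeasureTheory.measure_mono_null ?_ hN0
    rintro _ ⟨⟨s, y⟩, ⟨⟨hyU, B₁, τ₁, hB₁, hyB₁, hτ₁, h1', h2', hgr, hhe⟩, hyN, hyB⟩, rfl⟩
    simp only at hyU hyB₁ hgr hhe hyN hyB
    refine ⟨(s, π y), ⟨hyN, ?_⟩, rfl⟩
    have heq := (aux_section_eq hdn U B B₁ τ τ₁ y hyU hB hyB hB₁ hyB₁ hτ h1 h2 h1' h2').2
    have heq2 : (fun z => g (s, z)) =ᶠ[𝓝 (π y)] fun z => f s (τ₁ z) := by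
      filter_upwards [heq] with z hz
      simp only [g, hz]
    have hcg := aux_congr _ _ _ heq2
    refine ⟨hcg.1.trans hgr, ?_⟩
    rw [← hcg.2] at hhe
    obtain ⟨v, hv, hv0⟩ := Matrix.exists_vecMul_eq_zero_iff.2 hhe
    refine ⟨v, hv, ?_⟩
    funext j
    rw [(aux_deriv g (s, π y) (hgC s y hyU hyB)).2 v j]
    exact congrFun hv0 j
  rw [MeasureTheory.OuterMeasure.comap_apply] at hBd
  refine MeasureTheory.measure_mono_null ?_ hBd
  rintro t ⟨x, hxU, h⟩
  exact ⟨(t, x), ⟨hxU, h⟩, rfl⟩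

end DMinPaper
end
end
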